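/- For every k ≥ 0, k-marble transducers and k-layered streaming string transducers describe the same class of functions: a partial function f : A* → B* is computable by a k-marble transducer if and only if it is computable by a k-layered streaming string transducer. -/

import Mathlib

set_option autoImplicit false

/-! ### Asymptotic growth of functions `A* → ℕ` -/

/-- `g` has `k`-polynomial growth: `g(w) = O(|w|^k)` and there is an infinite set `L`
of words on which `g(w) = Ω(|w|^k)`. -/
def PolyGrowth {A : Type} (g : List A → ℕ) (k : ℕ) : Prop :=
  (∃ C : ℕ, ∀ w, g w ≤ C * w.length ^ k + C) ∧
  (∃ L : Set (List A), L.Infinite ∧ ∃ c : ℕ, 0 < c ∧ ∀ w ∈ L, w.length ^ k ≤ c * g w)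

/-- `g` has exponential growth: `g(w) = 2^{O(|w|)}` and there is an infinite set `L`
of words on which `g(w) = 2^{Ω(|w|)}`. -/
def ExpGrowth {A : Type} (g : List A → ℕ) : Prop :=
  (∃ C : ℕ, ∀ w, g w ≤ 2 ^ (C * w.length + C)) ∧
  (∃ L : Set (List A), L.Infinite ∧ ∃ c : ℕ, 0 < c ∧ ∀ w ∈ L, 2 ^ w.length ≤ (g w) ^ c)

/-! ### Substitutions -/

/-- Extension of a substitution `s : X → (B ⊎ X)*` to a morphism on `(B ⊎ X)*`
fixing the letters of `B`; this also gives the composition of substitutions,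
`(s₁ ∘ s₂) x = applySubst s₁ (s₂ x)`. -/
def applySubst {B X : Type} (s : X → List (B ⊕ X)) (l : List (B ⊕ X)) : List (B ⊕ X) :=
  l.flatMap (fun c => match c with | Sum.inl b => [Sum.inl b] | Sum.inr x => s x)

/-- Evaluation of a word over `B ⊎ X` under a valuation `v : X → B*` of the registers. -/
def evalSubst {B X : Type} (v : X → List B) (l : List (B ⊕ X)) : List B :=
  l.flatMap (fun c => match c with | Sum.inl b => [b] | Sum.inr x => v x)

/-- Number of occurrences of register `x` in a word over `B ⊎ X`. -/
noncomputable def occCount {B X : Type} (x : X) (l : List (B ⊕ X)) : ℕ :=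
  l.countP (fun c => @decide (c = Sum.inr x) (Classical.propDecidable _))

/-- Total number of occurrences of register `x` in the whole set of words `{s y | y ∈ X}`. -/
noncomputable def totalOcc {B X : Type} [Fintype X] (s : X → List (B ⊕ X)) (x : X) : ℕ :=
  ∑ y : X, occCount x (s y)

/-! ### Streaming string transducers -/

/-- A streaming string transducer (SST) with input alphabet `A` and output alphabet `B`:
finitely many states `Q` with initial state `q0`, finitely many registers `X` with
initial contents `init`, a partial transition/update function (`trans`, returning the
successor state together with the register update substitution, with a common domain),
and a partial output function `out`. -/
structure SST (A B : Type) where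
  Q : Type
  X : Type
  [finQ : Fintype Q]
  [finX : Fintype X]
  q0 : Q
  init : X → List B
  trans : Q → A → Option (Q × (X → List (B ⊕ X)))
  out : Q → Option (List (B ⊕ X))

attribute [instance] SST.finQ SST.finX

/-- Run of an SST from state `q` with current register valuation `v`. -/
def SST.runFrom {A B : Type} (T : SST A B) :
    T.Q → (T.X → List B) → List A → Option (T.Q × (T.X → List B))
  | q, v, [] => some (q, v)
  | q, v, a :: w =>
    match T.trans q a with
    | none => none
    | some (q', s) => T.runFrom q' (fun x => evalSubst v (s x)) w

/-- The (partial) function computed by an SST. -/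
def SST.eval {A B : Type} (T : SST A B) (w : List A) : Option (List B) :=
  (T.runFrom T.q0 T.init w).bind fun p => (T.out p.1).map fun o => evalSubst p.2 o

def SST.Computes {A B : Type} (T : SST A B) (f : List A → Option (List B)) : Prop :=
  ∀ w, T.eval w = f w

/-- An SST is copyless if every update substitution uses each register at most once
in total. -/
def SST.Copyless {A B : Type} (T : SST A B) : Prop :=
  ∀ q a p, T.trans q a = some p → ∀ x : T.X, totalOcc p.2 x ≤ 1

/-- An SST is `k`-layered if its registers can be partitioned into layers
`X_0, …, X_k` such that every update of a register of layer `i` only uses registers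
of layers `≤ i`, and each register of layer `i` is used at most once in total in the
updates of the registers of layer `i`. -/
def SST.IsLayered {A B : Type} (T : SST A B) (k : ℕ) : Prop :=
  ∃ layer : T.X → Fin (k + 1),
    ∀ q a p, T.trans q a = some p →
      (∀ x y, Sum.inr y ∈ p.2 x → layer y ≤ layer x) ∧
      (∀ y : T.X,
        (∑ x ∈ Finset.univ.filter (fun x => layer x = layer y), occCount y (p.2 x)) ≤ 1)

/-- The composed substitution `λ(q, w)` applied along the run reading `w` from state `q`
(together with the state reached). -/
def SST.substFrom {A B : Type} (T : SST A B) :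
    T.Q → List A → Option (T.Q × (T.X → List (B ⊕ T.X)))
  | q, [] => some (q, fun x => [Sum.inr x])
  | q, a :: w =>
    match T.trans q a with
    | none => none
    | some (q', s) => (T.substFrom q' w).map fun p => (p.1, fun x => applySubst s (p.2 x))

/-- An SST is `(k,B)`-bounded if its registers can be partitioned into layers
`X_0, …, X_k` such that every update of a register of layer `i` only uses registers of
layers `≤ i`, and for every state `q` and word `w`, each register of layer `i` occurs
at most `B` times in total in `{λ(q,w)(x) | x ∈ X_i}`. -/
def SST.IsBounded {A B : Type} (T : SST A B) (k Bd : ℕ) : Prop :=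
  ∃ layer : T.X → Fin (k + 1),
    (∀ q a p, T.trans q a = some p → ∀ x y, Sum.inr y ∈ p.2 x → layer y ≤ layer x) ∧
    (∀ q w p, T.substFrom q w = some p →
      ∀ y : T.X,
        (∑ x ∈ Finset.univ.filter (fun x => layer x = layer y), occCount y (p.2 x)) ≤ Bd)

/-! ### Simple SSTs -/

/-- A simple SST: total, a single state (hence no state component), and update
substitutions and output using no letters of `B`. -/
structure SimpleSST (A B : Type) where
  X : Type
  [finX : Fintype X]
  [decX : DecidableEq X]
  init : X → List B
  upd : A → X → List X
  out : List X

attribute [instance] SimpleSST.finX SimpleSST.decX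

/-- Register valuation of a simple SST after reading a word, starting from valuation `v`. -/
def SimpleSST.valFrom {A B : Type} (T : SimpleSST A B) :
    (T.X → List B) → List A → T.X → List B
  | v, [] => v
  | v, a :: w => T.valFrom (fun x => (T.upd a x).flatMap v) w

/-- Register valuation `𝒯^w` of a simple SST after reading `w`. -/
def SimpleSST.val {A B : Type} (T : SimpleSST A B) (w : List A) : T.X → List B :=
  T.valFrom T.init w

/-- The (total) function computed by a simple SST. -/
def SimpleSST.eval {A B : Type} (T : SimpleSST A B) (w : List A) : List B :=
  (T.out).flatMap (T.val w)

/-! ### Two-way transducers -/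

/-- A tape symbol: a letter of `A` or one of the two endmarkers `⊢`, `⊣`. -/
inductive TapeSym (A : Type) where
  | lend
  | rend
  | letter (a : A)

/-- The content of the tape `⊢w⊣` at position `m ∈ {0, …, |w|+1}`. -/
def tapeAt {A : Type} (w : List A) (m : ℕ) : TapeSym A :=
  if m = 0 then TapeSym.lend
  else
    match w[m - 1]? with
    | some a => TapeSym.letter a
    | none => TapeSym.rend

/-- Head moves. -/
inductive Dir where
  | left
  | right

/-- A deterministic two-way transducer: finitely many states with an initial state and
a set of final states, and a partial transition/output function (common domain). -/
structure TwoWayT (A B : Type) where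
  Q : Type
  [finQ : Fintype Q]
  q0 : Q
  final : Set Q
  trans : Q → TapeSym A → Option ((Q × Dir) × List B)

attribute [instance] TwoWayT.finQ

/-- `TwoWayT.Steps T w c v c'`: on input `⊢w⊣` the transducer can go from
configuration `c` to configuration `c'` producing output `v`. -/
inductive TwoWayT.Steps {A B : Type} (T : TwoWayT A B) (w : List A) :
    T.Q × ℕ → List B → T.Q × ℕ → Prop
  | refl (c : T.Q × ℕ) : TwoWayT.Steps T w c [] c
  | stepL {q : T.Q} {m : ℕ} {q' : T.Q} {v u : List B} {cf : T.Q × ℕ} :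
      T.trans q (tapeAt w m) = some ((q', Dir.left), v) → 1 ≤ m →
      TwoWayT.Steps T w (q', m - 1) u cf → TwoWayT.Steps T w (q, m) (v ++ u) cf
  | stepR {q : T.Q} {m : ℕ} {q' : T.Q} {v u : List B} {cf : T.Q × ℕ} :
      T.trans q (tapeAt w m) = some ((q', Dir.right), v) → m ≤ w.length →
      TwoWayT.Steps T w (q', m + 1) u cf → TwoWayT.Steps T w (q, m) (v ++ u) cf

/-- The two-way transducer computes the partial function `f`: `f w = some v` iff there
is an accepting run on `⊢w⊣` (from `(q0, 0)` to `(q, |w|+1)` with `q` final)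
producing `v`. -/
def TwoWayT.Computes {A B : Type} (T : TwoWayT A B) (f : List A → Option (List B)) : Prop :=
  ∀ w v, f w = some v ↔ ∃ q ∈ T.final, TwoWayT.Steps T w (T.q0, 0) v (q, w.length + 1)

/-! ### Marble transducers -/

/-- Actions of a marble transducer: move left, move right, lift the marble, or drop a
marble of color `c`. -/
inductive MAct (C : Type) where
  | left
  | right
  | lift
  | drop (c : C)

/-- A deterministic marble transducer: finitely many states with an initial state and a
set of final states, finitely many marble colors `C`, and a partial transition/output
function (common domain) reading the current state, the tape symbol, and the color of
the marble at the current position (if any); on a position carrying a marble the head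
may only move left or lift the marble. -/
structure MarbleT (A B : Type) where
  Q : Type
  C : Type
  [finQ : Fintype Q]
  [finC : Fintype C]
  q0 : Q
  final : Set Q
  trans : Q → TapeSym A → Option C → Option ((Q × MAct C) × List B)
  marble_left_or_lift : ∀ q s c p, trans q s (some c) = some p →
    p.1.2 = MAct.left ∨ p.1.2 = MAct.lift

attribute [instance] MarbleT.finQ MarbleT.finC

/-- The color of the marble at position `m`, for a stack `π` of dropped marbles
(topmost first, positions strictly increasing from the top and all ≥ the head
position). -/
def marbleAt {C : Type} (m : ℕ) : List (C × ℕ) → Option C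
  | [] => none
  | (c, p) :: _ => if p = m then some c else none

/-- `MarbleT.Steps T w c v c'`: on input `⊢w⊣` the marble transducer can go from
configuration `c` to configuration `c'` producing output `v`. A configuration is a
triple (state, head position, stack of dropped marbles). -/
inductive MarbleT.Steps {A B : Type} (T : MarbleT A B) (w : List A) :
    T.Q × ℕ × List (T.C × ℕ) → List B → T.Q × ℕ × List (T.C × ℕ) → Prop
  | refl (c : T.Q × ℕ × List (T.C × ℕ)) : MarbleT.Steps T w c [] c
  | stepL {q : T.Q} {m : ℕ} {π : List (T.C × ℕ)} {q' : T.Q} {v u : List B}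
      {cf : T.Q × ℕ × List (T.C × ℕ)} :
      T.trans q (tapeAt w m) (marbleAt m π) = some ((q', MAct.left), v) → 1 ≤ m →
      MarbleT.Steps T w (q', m - 1, π) u cf → MarbleT.Steps T w (q, m, π) (v ++ u) cf
  | stepR {q : T.Q} {m : ℕ} {π : List (T.C × ℕ)} {q' : T.Q} {v u : List B}
      {cf : T.Q × ℕ × List (T.C × ℕ)} :
      marbleAt m π = none →
      T.trans q (tapeAt w m) none = some ((q', MAct.right), v) → m ≤ w.length →
      MarbleT.Steps T w (q', m + 1, π) u cf → MarbleT.Steps T w (q, m, π) (v ++ u) cf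
  | stepLift {q : T.Q} {m : ℕ} {π : List (T.C × ℕ)} {q' : T.Q} {cc : T.C} {v u : List B}
      {cf : T.Q × ℕ × List (T.C × ℕ)} :
      T.trans q (tapeAt w m) (some cc) = some ((q', MAct.lift), v) →
      MarbleT.Steps T w (q', m, π) u cf →
      MarbleT.Steps T w (q, m, (cc, m) :: π) (v ++ u) cf
  | stepDrop {q : T.Q} {m : ℕ} {π : List (T.C × ℕ)} {q' : T.Q} {cc : T.C} {v u : List B}
      {cf : T.Q × ℕ × List (T.C × ℕ)} :
      marbleAt m π = none →
      T.trans q (tapeAt w m) none = some ((q', MAct.drop cc), v) →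
      MarbleT.Steps T w (q', m, (cc, m) :: π) u cf →
      MarbleT.Steps T w (q, m, π) (v ++ u) cf

/-- The marble transducer computes the partial function `f`: `f w = some v` iff there is
an accepting run on `⊢w⊣` (from `(q0, 0, ε)` to `(q, |w|+1, ε)` with `q` final)
producing `v`. -/
def MarbleT.Computes {A B : Type} (T : MarbleT A B) (f : List A → Option (List B)) : Prop :=
  ∀ w v, f w = some v ↔
    ∃ q ∈ T.final, MarbleT.Steps T w (T.q0, 0, []) v (q, w.length + 1, [])

/-- A `k`-marble transducer: every configuration reachable from the initial
configuration carries at most `k` marbles. -/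
def MarbleT.IsKMarble {A B : Type} (T : MarbleT A B) (k : ℕ) : Prop :=
  ∀ (w : List A) (u : List B) (cfg : T.Q × ℕ × List (T.C × ℕ)),
    MarbleT.Steps T w (T.q0, 0, []) u cfg → cfg.2.2.length ≤ k

/-- `f` is computable by a `k`-marble transducer. -/
def ComputableKMarble {A B : Type} (f : List A → List B) (k : ℕ) : Prop :=
  ∃ T : MarbleT A B, T.IsKMarble k ∧ T.Computes (fun w => some (f w))

/-! ### Matrices over ℕ and ℕ-automata -/

/-- Product of two square matrices over `ℕ` (given as functions). -/
def matMul {Q : Type} [Fintype Q] (M N : Q → Q → ℕ) : Q → Q → ℕ :=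
  fun i j => ∑ x : Q, M i x * N x j

/-- Identity matrix over `ℕ`. -/
def matId {Q : Type} [DecidableEq Q] : Q → Q → ℕ :=
  fun i j => if i = j then 1 else 0

/-- Row vector times matrix. -/
def vecMat {Q : Type} [Fintype Q] (v : Q → ℕ) (M : Q → Q → ℕ) : Q → ℕ :=
  fun j => ∑ x : Q, v x * M x j

/-- Matrix times column vector. -/
def matVec {Q : Type} [Fintype Q] (M : Q → Q → ℕ) (v : Q → ℕ) : Q → ℕ :=
  fun i => ∑ x : Q, M i x * v x

/-- Dot product of two vectors over `ℕ`. -/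
def dotProd {Q : Type} [Fintype Q] (v w : Q → ℕ) : ℕ :=
  ∑ x : Q, v x * w x

/-- An `ℕ`-automaton: a finite set of states `Q`, an initial row vector `α`, a weight
matrix `μ a` for every letter `a` (extended to words as a monoid morphism `μW`), and a
final column vector `β`. -/
structure NAut (A : Type) where
  Q : Type
  [finQ : Fintype Q]
  [decQ : DecidableEq Q]
  α : Q → ℕ
  μ : A → Q → Q → ℕ
  β : Q → ℕ

attribute [instance] NAut.finQ NAut.decQ

/-- The monoid morphism `A* → ℕ^{Q×Q}` extending `μ`. -/
def NAut.μW {A : Type} (T : NAut A) : List A → T.Q → T.Q → ℕ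
  | [] => matId
  | a :: w => matMul (T.μ a) (T.μW w)

/-- The total function `g : A* → ℕ` computed by the `ℕ`-automaton: `g w = α·μ(w)·β`. -/
def NAut.g {A : Type} (T : NAut A) (w : List A) : ℕ :=
  dotProd (vecMat T.α (T.μW w)) T.β

/-- Trimness: every state is accessible and co-accessible with nonzero weight. -/
def NAut.Trim {A : Type} (T : NAut A) : Prop :=
  ∀ q : T.Q, (∃ u, 1 ≤ vecMat T.α (T.μW u) q) ∧ (∃ v, 1 ≤ matVec (T.μW v) T.β q)

/-- A heavy cycle on state `q`: a nonempty word `v` with `μ(v)(q,q) ≥ 2`. -/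
def NAut.HeavyCycle {A : Type} (T : NAut A) (q : T.Q) (v : List A) : Prop :=
  v ≠ [] ∧ 2 ≤ T.μW v q q

/-- A barbell from `q` to `q' ≠ q`: a nonempty word `v` with `μ(v)(q,q) ≥ 1`,
`μ(v)(q,q') ≥ 1` and `μ(v)(q',q') ≥ 1`. -/
def NAut.Barbell {A : Type} (T : NAut A) (q q' : T.Q) (v : List A) : Prop :=
  q ≠ q' ∧ v ≠ [] ∧ 1 ≤ T.μW v q q ∧ 1 ≤ T.μW v q q' ∧ 1 ≤ T.μW v q' q'

/-- Edge of the barbell graph `𝔊`. -/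
def NAut.GEdge {A : Type} (T : NAut A) (q1 q2 : T.Q) : Prop :=
  ∃ q q' v, T.Barbell q q' v ∧ (∃ w, 1 ≤ T.μW w q1 q) ∧ (∃ w', 1 ≤ T.μW w' q' q2)

/-- `PathLen G q n`: there is a directed path of length `n` (counting edges) in the
graph `G` ending in `q`. -/
inductive PathLen {Q : Type} (G : Q → Q → Prop) : Q → ℕ → Prop
  | zero (q : Q) : PathLen G q 0
  | succ {p q : Q} {n : ℕ} : PathLen G p n → G p q → PathLen G q (n + 1)

/-- The height of `q` in the graph `G` is `n`: the maximal length of a directed path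
ending in `q` is `n`. -/
def HeightIs {Q : Type} (G : Q → Q → Prop) (q : Q) (n : ℕ) : Prop :=
  PathLen G q n ∧ ∀ m, PathLen G q m → m ≤ n

/-! ### Statement-specific predicates -/

/-- Case (1) of the trichotomy: `|f|` has exponential growth and `f` is not computable
with `k` marbles for any `k`. -/
def MarbleCase1 {A B : Type} (f : List A → List B) : Prop :=
  ExpGrowth (fun w => (f w).length) ∧ ∀ k : ℕ, ¬ ComputableKMarble f k

/-- Case (2) of the trichotomy: `|f|` has `(k+1)`-polynomial growth for some `k`, `f` is
computable with `k` marbles, and `k` is the least possible number of marbles. -/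
def MarbleCase2 {A B : Type} (f : List A → List B) : Prop :=
  ∃ k : ℕ, PolyGrowth (fun w => (f w).length) (k + 1) ∧ ComputableKMarble f k ∧
    ∀ j : ℕ, ComputableKMarble f j → k ≤ j

/-- Case (3) of the trichotomy: `|f|` has `0`-polynomial growth and `f` is computable
with `0` marbles. -/
def MarbleCase3 {A B : Type} (f : List A → List B) : Prop :=
  PolyGrowth (fun w => (f w).length) 0 ∧ ComputableKMarble f 0

/-- The second alternative of Lemma `lem:graph`: `g` has `k`-polynomial growth for some
`k ≥ 0` and the states admit a partition `S_0, …, S_k` satisfying (a), (b), (c). -/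
def NAutPolyCase {A : Type} (T : NAut A) : Prop :=
  ∃ k : ℕ, PolyGrowth T.g k ∧
    ∃ S : T.Q → Fin (k + 1),
      (∀ q q' : T.Q, (∃ w, 1 ≤ T.μW w q q') → S q ≤ S q') ∧
      (∃ Bd : ℕ, ∀ q q' : T.Q, S q = S q' → ∀ w, T.μW w q q' ≤ Bd) ∧
      (∀ q : T.Q, ∃ C : ℕ, ∀ w, vecMat T.α (T.μW w) q ≤ C * w.length ^ (S q : ℕ) + C)


namespace MS

open Classical

/-! ### Generic deterministic runs -/

inductive Path {C : Type} (nx : C → Option C) (E : C → Prop) : C → List C → C → Prop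
  | nil {c : C} : E c → Path nx E c [] c
  | cons {c c' : C} {L : List C} {e : C} :
      ¬ E c → nx c = some c' → Path nx E c' L e → Path nx E c (c :: L) e

theorem Path.exit {C : Type} {nx : C → Option C} {E : C → Prop} {c e : C} {L : List C}
    (h : Path nx E c L e) : E e := by
  induction h with
  | nil h => exact h
  | cons _ _ _ ih => exact ih

theorem Path.uniq {C : Type} {nx : C → Option C} {E : C → Prop} {c e : C} {L : List C}
    (h : Path nx E c L e) : ∀ {L' : List C} {e' : C}, Path nx E c L' e' → L = L' ∧ e = e' := by
  induction h with
  | nil h =>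
    intro L' e' h'
    cases h' with
    | nil _ => exact ⟨rfl, rfl⟩
    | cons h1 _ _ => exact absurd h h1
  | cons h1 h2 _ ih =>
    intro L' e' h'
    cases h' with
    | nil h => exact absurd h h1
    | cons _ h4 h5 =>
      rw [h2] at h4
      obtain rfl := Option.some.inj h4
      obtain ⟨rfl, rfl⟩ := ih h5
      exact ⟨rfl, rfl⟩

theorem Path.suffix {C : Type} {nx : C → Option C} {E : C → Prop} {x e : C} {s : List C}
    (u : List C) : ∀ {c : C}, Path nx E c (u ++ x :: s) e → Path nx E x (x :: s) e := by
  induction u with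
  | nil =>
    intro c h
    cases h with
    | cons h1 h2 h3 => exact Path.cons h1 h2 h3
  | cons a u ih =>
    intro c h
    cases h with
    | cons h1 h2 h3 => exact ih h3

theorem Path.append {C : Type} {nx : C → Option C} {E E' : C → Prop} (hE : ∀ c, E' c → E c)
    {c e e' : C} {L L' : List C}
    (h : Path nx E c L e) (h' : Path nx E' e L' e') : Path nx E' c (L ++ L') e' := by
  induction h with
  | nil _ => exact h'
  | cons h1 h2 _ ih => exact Path.cons (fun h => h1 (hE _ h)) h2 (ih h')

theorem Path.split {C : Type} {nx : C → Option C} {E E' : C → Prop} (hE : ∀ c, E' c → E c)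
    {c e' : C} {L : List C} (h : Path nx E' c L e') :
    ∃ L1 e L2, Path nx E c L1 e ∧ Path nx E' e L2 e' ∧ L = L1 ++ L2 := by
  induction h with
  | nil h => exact ⟨[], _, [], Path.nil (hE _ h), Path.nil h, rfl⟩
  | @cons c c' L e h1 h2 h3 ih =>
    by_cases hc : E c
    · exact ⟨[], c, c :: L, Path.nil hc, Path.cons h1 h2 h3, rfl⟩
    · obtain ⟨L1, e1, L2, p1, p2, rfl⟩ := ih
      exact ⟨c :: L1, e1, L2, Path.cons hc h2 p1, p2, rfl⟩

noncomputable def run {C : Type} (nx : C → Option C) (E : C → Prop) (c : C) :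
    Option (C × List C) :=
  if h : ∃ p : C × List C, Path nx E c p.2 p.1 then some h.choose else none

theorem run_eq_some {C : Type} {nx : C → Option C} {E : C → Prop} {c e : C} {L : List C} :
    run nx E c = some (e, L) ↔ Path nx E c L e := by
  unfold run
  constructor
  · intro h
    split_ifs at h with h1
    have := h1.choose_spec
    rw [Option.some.inj h] at this
    exact this
  · intro h
    have h1 : ∃ p : C × List C, Path nx E c p.2 p.1 := ⟨(e, L), h⟩
    rw [dif_pos h1]
    obtain ⟨h3, h4⟩ := h1.choose_spec.uniq h
    congr 1
    exact Prod.ext h4 h3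

theorem run_congr {C C' : Type} {nx : C → Option C} {E : C → Prop} {c : C}
    {nx' : C' → Option C'} {E' : C' → Prop} {c' : C'}
    (e : C → C') (g : List C → List C')
    (h1 : ∀ L x, Path nx E c L x → Path nx' E' c' (g L) (e x))
    (h2 : ∀ L x, Path nx' E' c' L x → ∃ L' x', Path nx E c L' x') :
    run nx' E' c' = (run nx E c).map (fun p => (e p.1, g p.2)) := by
  cases h : run nx E c with
  | some p =>
    obtain ⟨x, L⟩ := p
    have := h1 L x (run_eq_some.1 h)
    simpa using run_eq_some.2 this
  | none =>
    cases h' : run nx' E' c' with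
    | none => rfl
    | some p =>
      obtain ⟨x, L⟩ := p
      obtain ⟨L', x', hp⟩ := h2 L x (run_eq_some.1 h')
      rw [run_eq_some.2 hp] at h
      cases h

/-! ### Suffix sharing families of lists -/

/-- Suffix sharing. -/
def SS {Q C : Type} (LL : Q → List C) : Prop :=
  ∀ q1 q2 x u1 u2 s1 s2, LL q1 = u1 ++ x :: s1 → LL q2 = u2 ++ x :: s2 → s1 = s2

theorem SS.nodup {Q C : Type} {LL : Q → List C} (h : SS LL) (q : Q) : (LL q).Nodup := by
  have key : ∀ (u v : List C), LL q = u ++ v → v.Nodup := by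
    intro u v
    induction v generalizing u with
    | nil => intro _; exact List.nodup_nil
    | cons a v ih =>
      intro hq
      rw [List.nodup_cons]
      constructor
      · intro ha
        obtain ⟨s, t, rfl⟩ := List.append_of_mem ha
        have := h q q a u (u ++ a :: s) (s ++ a :: t) t hq (by rw [hq]; simp)
        have := congrArg List.length this
        simp at this
        omega
      · exact ih (u ++ [a]) (by rw [hq]; simp)
  exact key [] _ rfl

noncomputable def supp {Q C : Type} [Fintype Q] (LL : Q → List C) (x : C) : Finset Q :=
  Finset.univ.filter (fun q => x ∈ LL q)

theorem mem_supp {Q C : Type} [Fintype Q] (LL : Q → List C) (x : C) (q : Q) :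
    q ∈ supp LL x ↔ x ∈ LL q := by simp [supp]

noncomputable def block {Q C : Type} [Fintype Q] (LL : Q → List C) (U : Finset Q) : List C :=
  if h : ∃ q, q ∈ U then (LL h.choose).filter (fun x => supp LL x = U) else []

theorem SS.filter_eq {Q C : Type} {LL : Q → List C} (h : SS LL) (q2 : Q) (P : C → Bool) :
    ∀ (L1 : List C) (q1 : Q) (u : List C), LL q1 = u ++ L1 →
      (∀ x, P x = true → x ∈ L1 → x ∈ LL q2) → (∀ x, P x = true → x ∈ LL q2 → x ∈ L1) →
      L1.filter P = (LL q2).filter P := by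
  intro L1
  induction L1 with
  | nil =>
    intro q1 u _ _ h2
    symm
    rw [List.filter_nil, List.filter_eq_nil_iff]
    intro a ha hP
    exact absurd (h2 a hP ha) (by simp)
  | cons c L1 ih =>
    intro q1 u hq h1 h2
    by_cases hc : P c = true
    · have hm := h1 c hc (by simp)
      obtain ⟨s, t, hst⟩ := List.append_of_mem hm
      have ht := h q1 q2 c u s L1 t hq hst
      subst ht
      have hn := h.nodup q2
      rw [hst] at hn ⊢
      rw [List.filter_append]
      have : s.filter P = [] := by
        rw [List.filter_eq_nil_iff]
        intro a ha hP
        have := h2 a hP (by rw [hst]; simp [ha])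
        have hd := (List.nodup_append.1 hn).2.2
        exact hd a ha a this rfl
      rw [this]; rfl
    · rw [List.filter_cons_of_neg hc]
      refine ih q1 (u ++ [c]) (by rw [hq]; simp) ?_ ?_
      · intro x hx hm
        exact h1 x hx (by simp [hm])
      · intro x hx hm
        have := h2 x hx hm
        rcases List.mem_cons.1 this with rfl | h3
        · exact absurd hx hc
        · exact h3

theorem block_eq {Q C : Type} [Fintype Q] {LL : Q → List C} (h : SS LL) {U : Finset Q} {q : Q}
    (hq : q ∈ U) : block LL U = (LL q).filter (fun x => supp LL x = U) := by
  unfold block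
  have h1 : ∃ q, q ∈ U := ⟨q, hq⟩
  rw [dif_pos h1]
  refine h.filter_eq q _ _ h1.choose [] rfl ?_ ?_
  · intro x hx _
    rw [← mem_supp, of_decide_eq_true hx]; exact hq
  · intro x hx _
    rw [← mem_supp, of_decide_eq_true hx]; exact h1.choose_spec

theorem block_sub {Q C : Type} [Fintype Q] {LL : Q → List C} {U : Finset Q} {x : C}
    (hx : x ∈ block LL U) : supp LL x = U := by
  unfold block at hx
  split_ifs at hx with h
  · simpa using (List.mem_filter.1 hx).2
  · simp at hx

theorem exists_subs (Q : Type) [Fintype Q] : ∃ l : List (Finset Q), l.Nodup ∧ (∀ U, U ∈ l) ∧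
    l.Pairwise (fun U V => U.card ≤ V.card) := by
  refine ⟨(Finset.univ : Finset (Finset Q)).toList.insertionSort (fun U V => U.card ≤ V.card),
    ?_, ?_, ?_⟩
  · exact ((List.perm_insertionSort _ _).nodup_iff).2 (Finset.nodup_toList _)
  · intro U
    rw [(List.perm_insertionSort _ _).mem_iff]
    simp
  · have : Std.Total (fun U V : Finset Q => U.card ≤ V.card) := ⟨fun a b => le_total _ _⟩
    have : IsTrans (Finset Q) (fun U V : Finset Q => U.card ≤ V.card) :=
      ⟨fun a b c h1 h2 => le_trans h1 h2⟩
    exact List.pairwise_insertionSort _ _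

noncomputable def subs (Q : Type) [Fintype Q] : List (Finset Q) := (exists_subs Q).choose
theorem subs_nodup (Q : Type) [Fintype Q] : (subs Q).Nodup := (exists_subs Q).choose_spec.1
theorem mem_subs {Q : Type} [Fintype Q] (U : Finset Q) : U ∈ subs Q :=
  (exists_subs Q).choose_spec.2.1 U
theorem subs_sorted (Q : Type) [Fintype Q] : (subs Q).Pairwise (fun U V => U.card ≤ V.card) :=
  (exists_subs Q).choose_spec.2.2

theorem filter_split {C : Type} (P : C → Bool) (L : List C)
    (h : L.Pairwise (fun x y => P y = true → P x = true)) :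
    L = L.filter P ++ L.filter (fun x => !P x) := by
  induction L with
  | nil => rfl
  | cons a L ih =>
    rw [List.pairwise_cons] at h
    by_cases ha : P a = true
    · rw [List.filter_cons_of_pos ha, List.filter_cons_of_neg (by simp [ha]), List.cons_append,
        ← ih h.2]
    · have h0 : (a :: L).filter P = [] := by
        rw [List.filter_eq_nil_iff]
        intro x hx hP
        rcases List.mem_cons.1 hx with rfl | h3
        · exact ha hP
        · exact ha (h.1 x h3 hP)
      rw [h0, List.nil_append]
      symm
      rw [List.filter_eq_self]
      intro x hx
      rw [List.filter_eq_nil_iff] at h0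
      simpa using h0 x hx

theorem sorted_decomp {Q C : Type} (s : C → Finset Q) (S : List (Finset Q)) :
    ∀ (L : List C), S.Nodup → S.Pairwise (fun U V => U.card ≤ V.card) →
    (∀ x ∈ L, s x ∈ S) → L.Pairwise (fun x y => s x ⊆ s y) →
    L = S.flatMap (fun U => L.filter (fun x => s x = U)) := by
  induction S with
  | nil =>
    intro L _ _ h _
    cases L with
    | nil => rfl
    | cons a L => exact absurd (h a (by simp)) (by simp)
  | cons U S ih =>
    intro L hn hs hm hp
    rw [List.nodup_cons] at hn
    rw [List.pairwise_cons] at hs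
    have h1 := filter_split (fun x => decide (s x = U)) L (by
      refine List.Pairwise.imp_of_mem ?_ hp
      intro x y hx hy hxy hU
      simp only [decide_eq_true_eq] at hU ⊢
      rcases List.mem_cons.1 (hm x hx) with h | h
      · exact h
      · refine Finset.eq_of_subset_of_card_le (hU ▸ hxy) (hs.1 _ h))
    rw [List.flatMap_cons]
    have h2 := ih (L.filter (fun x => !decide (s x = U))) hn.2 hs.2 (by
      intro x hx
      rw [List.mem_filter] at hx
      rcases List.mem_cons.1 (hm x hx.1) with h | h
      · simp [h] at hx
      · exact h) (hp.sublist List.filter_sublist)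
    nth_rewrite 1 [h1]
    congr 1
    rw [h2]
    refine List.flatMap_congr ?_
    intro V hV
    rw [List.filter_filter]
    refine List.filter_congr ?_
    intro x _
    by_cases hx : s x = V
    · have : s x ≠ U := by
        rintro rfl
        exact hn.1 (hx ▸ hV)
      simp [hx]
      intro h; exact this (hx.trans h)
    · simp [hx]

theorem SS.decomp {Q C : Type} [Fintype Q] {LL : Q → List C} (h : SS LL) (q : Q) :
    LL q = ((subs Q).filter (fun U => q ∈ U)).flatMap (block LL) := by
  have hp : (LL q).Pairwise (fun x y => supp LL x ⊆ supp LL y) := by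
    have key : ∀ (v u : List C), LL q = u ++ v →
        v.Pairwise (fun x y => supp LL x ⊆ supp LL y) := by
      intro v
      induction v with
      | nil => intro _ _; exact List.Pairwise.nil
      | cons a v ih =>
        intro u hu
        rw [List.pairwise_cons]
        refine ⟨?_, ih (u ++ [a]) (by rw [hu]; simp)⟩
        intro y hy p hp
        rw [mem_supp] at hp ⊢
        obtain ⟨s, t, hst⟩ := List.append_of_mem hp
        have := h q p a u s v t hu hst
        subst this
        rw [hst]; simp [hy]
    exact key _ [] rfl
  have h1 := sorted_decomp (supp LL) (subs Q) (LL q) (subs_nodup Q) (subs_sorted Q)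
    (fun x _ => mem_subs _) hp
  nth_rewrite 1 [h1]
  generalize subs Q = S
  induction S with
  | nil => rfl
  | cons U S ih =>
    rw [List.flatMap_cons, ih]
    by_cases hU : q ∈ U
    · rw [List.filter_cons_of_pos (by simpa using hU), List.flatMap_cons, block_eq h hU]
    · rw [List.filter_cons_of_neg (by simpa using hU)]
      have : (LL q).filter (fun x => supp LL x = U) = [] := by
        rw [List.filter_eq_nil_iff]
        intro x hx hs
        simp only [decide_eq_true_eq] at hs
        exact hU (hs ▸ (mem_supp LL x q).2 hx)
      rw [this, List.nil_append]

theorem flatMap_dedup {F C : Type} (val : F → List C) (l : List F)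
    (h : (l.flatMap val).Nodup) : l.dedup.flatMap val = l.flatMap val := by
  induction l with
  | nil => rfl
  | cons a l ih =>
    rw [List.flatMap_cons, List.nodup_append] at h
    by_cases ha : a ∈ l
    · rw [List.dedup_cons_of_mem ha, ih h.2.1, List.flatMap_cons]
      have : val a = [] := by
        rw [List.eq_nil_iff_forall_not_mem]
        intro x hx
        exact h.2.2 x hx x (List.mem_flatMap.2 ⟨a, ha, hx⟩) rfl
      rw [this]; rfl
    · rw [List.dedup_cons_of_notMem ha, List.flatMap_cons, ih h.2.1, List.flatMap_cons]

/-- The formal update. -/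
noncomputable def fupd {Q F : Type} [Fintype Q] (fa : Q → List F) (V : Finset Q) : List F :=
  if h : ∃ q, q ∈ V then ((fa h.choose).filter (fun α => supp fa α = V)).dedup else []

theorem block_fupd {Q C F : Type} [Fintype Q] {LL : Q → List C} (h : SS LL)
    (fa : Q → List F) (val : F → List C) (hfa : ∀ q, LL q = (fa q).flatMap val)
    (hval : ∀ α β x, x ∈ val α → x ∈ val β → α = β) (V : Finset Q) :
    block LL V = (fupd fa V).flatMap val := by
  unfold fupd
  split_ifs with hV
  · have hq := hV.choose_spec
    generalize hV.choose = q at hq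
    have hs : ∀ α x, x ∈ val α → supp LL x = supp fa α := by
      intro α x hx
      ext p
      rw [mem_supp, mem_supp, hfa, List.mem_flatMap]
      constructor
      · rintro ⟨β, hβ, hx'⟩
        rw [hval α β x hx hx']; exact hβ
      · intro hα; exact ⟨α, hα, hx⟩
    have key : ∀ l : List F, (l.flatMap val).filter (fun x => supp LL x = V) =
        (l.filter (fun α => supp fa α = V)).flatMap val := by
      intro l
      induction l with
      | nil => rfl
      | cons a l ih =>
        rw [List.flatMap_cons, List.filter_append, ih]
        by_cases ha : supp fa a = V
        · rw [List.filter_cons_of_pos (by simpa using ha), List.flatMap_cons]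
          congr 1
          rw [List.filter_eq_self]
          intro x hx
          simp [hs a x hx, ha]
        · rw [List.filter_cons_of_neg (by simpa using ha)]
          have : (val a).filter (fun x => supp LL x = V) = [] := by
            rw [List.filter_eq_nil_iff]
            intro x hx
            simp [hs a x hx, ha]
          rw [this, List.nil_append]
    rw [block_eq h hq, hfa, key, flatMap_dedup]
    rw [← key, ← hfa]
    exact (h.nodup q).filter _
  · rw [block, dif_neg hV]; rfl

theorem fupd_nodup {Q F : Type} [Fintype Q] (fa : Q → List F) (V : Finset Q) :
    (fupd fa V).Nodup := by
  unfold fupd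
  split_ifs
  · exact List.nodup_dedup _
  · exact List.nodup_nil

theorem mem_fupd {Q F : Type} [Fintype Q] {fa : Q → List F} {V : Finset Q} {α : F}
    (h : α ∈ fupd fa V) : supp fa α = V := by
  unfold fupd at h
  split_ifs at h
  · rw [List.mem_dedup, List.mem_filter] at h
    simpa using h.2
  · simp at h

end MS

namespace MS

open Classical

/-! ### Layer systems -/

abbrev Tr (Q Cl Sy B : Type) := Q → Sy → Option Cl → Option ((Q × MAct Cl) × List B)

def IsR {Q : Type} (x : Q ⊕ Q) : Prop := x.isRight = true

/-- One macro step of the run on a marked cell. -/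
def mstep {Q Cl Sy B O : Type} (tr : Tr Q Cl Sy B) (a : Sy) (c : Cl)
    (ex : Q → Option (Q × List O)) (emb : List B → List O) :
    Q ⊕ Q → Option ((Q ⊕ Q) × List O)
  | Sum.inl p =>
    match tr p a (some c) with
    | some ((p', MAct.left), v) => (ex p').map (fun e => (Sum.inl e.1, emb v ++ e.2))
    | some ((p', MAct.lift), v) => some (Sum.inr p', emb v)
    | _ => none
  | Sum.inr _ => none

def nxOf {C O : Type} (f : C → Option (C × List O)) (c : C) : Option C := (f c).map Prod.fst
def oOf {C O : Type} (f : C → Option (C × List O)) (c : C) : List O :=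
  ((f c).map Prod.snd).getD []

/-- The run between the drop and the lift of a marble. -/
noncomputable def subRun {Q Cl Sy B O : Type} (tr : Tr Q Cl Sy B) (a : Sy) (c : Cl)
    (ex : Q → Option (Q × List O)) (emb : List B → List O) (q : Q) : Option (Q × List O) :=
  match run (nxOf (mstep tr a c ex emb)) IsR (Sum.inl q) with
  | some (Sum.inr p, L) => some (p, L.flatMap (oOf (mstep tr a c ex emb)))
  | _ => none

inductive NRes (Q : Type) where
  | left (q : Q)
  | right (q : Q)
  | stay (q : Q)

/-- One macro step on an unmarked cell. -/
noncomputable def nstep {Q Cl Sy B O : Type} (tr : Tr Q Cl Sy B) (a : Sy)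
    (low : Option (Q → Option (Q × List O))) (emb : List B → List O) (q : Q) :
    Option (NRes Q × List O) :=
  match tr q a none with
  | some ((q', MAct.left), v) => some (NRes.left q', emb v)
  | some ((q', MAct.right), v) => some (NRes.right q', emb v)
  | some ((q', MAct.drop c), v) =>
    match low with
    | none => none
    | some ex => (subRun tr a c ex emb q').map (fun p => (NRes.stay p.1, emb v ++ p.2))
  | some ((_, MAct.lift), _) => none
  | none => none

structure Sys (Q B : Type) where
  nx : Q × ℕ → Option (Q × ℕ)
  o : Q × ℕ → List B

noncomputable def vis {Q B : Type} (g : Sys Q B) : ℕ → Q → Option ((Q × ℕ) × List (Q × ℕ))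
  | 0, _ => none
  | n + 1, q => run g.nx (fun c => n + 1 ≤ c.2) (q, n)

noncomputable def exc {Q B : Type} (g : Sys Q B) (n : ℕ) (q : Q) : Option (Q × List B) :=
  (vis g n q).map (fun p => (p.1.1, p.2.flatMap g.o))

noncomputable def gs {Q Cl Sy B : Type} (tr : Tr Q Cl Sy B) (τ : ℕ → Sy)
    (low : Option (Sys Q B)) : Sys Q B where
  nx c :=
    match nstep tr (τ c.2) (low.map (fun g => exc g c.2)) id c.1 with
    | some (NRes.left q', _) => (match c.2 with | 0 => none | j + 1 => some (q', j))
    | some (NRes.right q', _) => some (q', c.2 + 1)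
    | some (NRes.stay q', _) => some (q', c.2)
    | none => none
  o c := ((nstep tr (τ c.2) (low.map (fun g => exc g c.2)) id c.1).map Prod.snd).getD []

noncomputable def gsys {Q Cl Sy B : Type} (tr : Tr Q Cl Sy B) (τ : ℕ → Sy) : ℕ → Sys Q B
  | 0 => gs tr τ none
  | l + 1 => gs tr τ (some (gsys tr τ l))

/-! ### Formal level -/

noncomputable def wd {Q : Type} (B : Type) [Fintype Q] (tag : Bool) (q : Q) :
    List (B ⊕ (Bool × Finset Q)) :=
  ((subs Q).filter (fun U => q ∈ U)).map (fun U => Sum.inr (tag, U))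

noncomputable def fex {Q : Type} (B : Type) [Fintype Q] (tag : Bool) (r : Q → Option Q) (q : Q) :
    Option (Q × List (B ⊕ (Bool × Finset Q))) :=
  (r q).map (fun e => (e, wd B tag q))

noncomputable def fnode {Q Cl Sy B : Type} [Fintype Q] (tr : Tr Q Cl Sy B) (a : Sy)
    (low : Option (Q → Option Q)) (q : Q) : Option (NRes Q × List (B ⊕ (Bool × Finset Q))) :=
  nstep tr a (low.map (fex B false)) (List.map Sum.inl) q

noncomputable def fnx {Q Cl Sy B : Type} [Fintype Q] (tr : Tr Q Cl Sy B) (a : Sy)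
    (r : Q → Option Q) (low : Option (Q → Option Q)) : Q ⊕ Q → Option (Q ⊕ Q)
  | Sum.inl q =>
    match fnode tr a low q with
    | some (NRes.left q', _) => (r q').map Sum.inl
    | some (NRes.right q', _) => some (Sum.inr q')
    | some (NRes.stay q', _) => some (Sum.inl q')
    | none => none
  | Sum.inr _ => none

noncomputable def fat {Q Cl Sy B : Type} [Fintype Q] (tr : Tr Q Cl Sy B) (a : Sy)
    (low : Option (Q → Option Q)) : Q ⊕ Q → List (Q ⊕ Finset Q)
  | Sum.inl p => Sum.inl p ::
    (match fnode tr a low p with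
    | some (NRes.left q', _) => ((subs Q).filter (fun U => q' ∈ U)).map Sum.inr
    | _ => [])
  | Sum.inr _ => []

noncomputable def fatoms {Q Cl Sy B : Type} [Fintype Q] (tr : Tr Q Cl Sy B) (a : Sy)
    (r : Q → Option Q) (low : Option (Q → Option Q)) (q : Q) : List (Q ⊕ Finset Q) :=
  match run (fnx tr a r low) IsR (Sum.inl q) with
  | some (_, L) => L.flatMap (fat tr a low)
  | none => []

noncomputable def fexit {Q Cl Sy B : Type} [Fintype Q] (tr : Tr Q Cl Sy B) (a : Sy)
    (r : Q → Option Q) (low : Option (Q → Option Q)) (q : Q) : Option Q :=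
  match run (fnx tr a r low) IsR (Sum.inl q) with
  | some (Sum.inr e, _) => some e
  | _ => none

noncomputable def flet {Q Cl Sy B : Type} [Fintype Q] (tr : Tr Q Cl Sy B) (a : Sy)
    (low : Option (Q → Option Q)) : Q ⊕ Finset Q → List (B ⊕ (Bool × Finset Q))
  | Sum.inl p => ((fnode tr a low p).map Prod.snd).getD []
  | Sum.inr U => [Sum.inr (true, U)]

noncomputable def upd {Q Cl Sy B : Type} [Fintype Q] (tr : Tr Q Cl Sy B) (a : Sy)
    (r : Q → Option Q) (low : Option (Q → Option Q)) (V : Finset Q) :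
    List (B ⊕ (Bool × Finset Q)) :=
  (fupd (fatoms tr a r low) V).flatMap (flet tr a low)

/-! ### Semantic data -/

noncomputable def LLn {Q B : Type} (g : Sys Q B) (n : ℕ) (q : Q) : List (Q × ℕ) :=
  match vis g n q with
  | some (_, L) => L
  | none => []

noncomputable def rho {Q B : Type} (g : Sys Q B) (n : ℕ) (q : Q) : Option Q :=
  (vis g n q).map (fun p => p.1.1)

noncomputable def valn {Q B : Type} [Fintype Q] (g : Sys Q B) (n : ℕ) (U : Finset Q) : List B :=
  (block (LLn g n) U).flatMap g.o

noncomputable def fval {Q B : Type} [Fintype Q] (g : Sys Q B) (low : Option (Sys Q B)) (n : ℕ) :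
    Bool × Finset Q → List B
  | (true, U) => valn g n U
  | (false, U) => match low with | some g' => valn g' n U | none => []

theorem evalSubst_append {B X : Type} (v : X → List B) (l l' : List (B ⊕ X)) :
    evalSubst v (l ++ l') = evalSubst v l ++ evalSubst v l' := by
  simp [evalSubst, List.flatMap_append]

theorem evalSubst_nil {B X : Type} (v : X → List B) : evalSubst v [] = [] := rfl

theorem evalSubst_inl {B X : Type} (v : X → List B) (l : List B) :
    evalSubst v (l.map Sum.inl) = l := by
  simp [evalSubst, List.flatMap_map]

theorem evalSubst_flatMap {B X F : Type} (v : X → List B) (l : List F) (g : F → List (B ⊕ X)) :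
    evalSubst v (l.flatMap g) = l.flatMap (fun α => evalSubst v (g α)) := by
  simp [evalSubst, List.flatMap_assoc]

theorem SS_LLn {Q B : Type} (g : Sys Q B) (n : ℕ) : SS (LLn g n) := by
  intro q1 q2 x u1 u2 s1 s2 h1 h2
  have key : ∀ q u s, LLn g n q = u ++ x :: s →
      ∃ e, Path g.nx (fun c => n ≤ c.2) x (x :: s) e := by
    intro q u s h
    cases n with
    | zero => simp [LLn, vis] at h
    | succ n =>
      cases hr : vis g (n + 1) q with
      | none => simp [LLn, hr] at h
      | some p =>
        obtain ⟨e, L⟩ := p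
        have h' : L = u ++ x :: s := by simpa [LLn, hr] using h
        have := run_eq_some.1 hr
        rw [h'] at this
        exact ⟨e, this.suffix u⟩
  obtain ⟨e1, p1⟩ := key q1 u1 s1 h1
  obtain ⟨e2, p2⟩ := key q2 u2 s2 h2
  have := (p1.uniq p2).1
  exact (List.cons.inj this).2

theorem eval_wd {Q B : Type} [Fintype Q] (g : Sys Q B) (n : ℕ) (tag : Bool)
    (v : Bool × Finset Q → List B) (hv : ∀ U, v (tag, U) = valn g n U) (q : Q) :
    evalSubst v (wd B tag q) = (LLn g n q).flatMap g.o := by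
  conv_rhs => rw [(SS_LLn g n).decomp q]
  unfold wd
  rw [List.flatMap_assoc]
  unfold evalSubst
  rw [List.flatMap_map]
  refine List.flatMap_congr ?_
  intro U _
  simp only [hv]
  rfl

theorem exc_eq {Q B : Type} [Fintype Q] (g : Sys Q B) (n : ℕ) (tag : Bool)
    (v : Bool × Finset Q → List B) (hv : ∀ U, v (tag, U) = valn g n U) (q : Q) :
    exc g n q = (fex B tag (rho g n) q).map (Prod.map id (evalSubst v)) := by
  unfold exc fex rho
  cases h : vis g n q with
  | none => rfl
  | some p =>
    simp only [Option.map_some, Prod.map, id]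
    rw [eval_wd g n tag v hv]
    simp [LLn, h]

theorem mstep_eq {Q Cl Sy B O O' : Type} (tr : Tr Q Cl Sy B) (a : Sy) (c : Cl)
    (ex : Q → Option (Q × List O)) (ex' : Q → Option (Q × List O'))
    (emb : List B → List O) (emb' : List B → List O') (ev : List O → List O')
    (hev : ∀ l l', ev (l ++ l') = ev l ++ ev l') (hemb : ∀ l, ev (emb l) = emb' l)
    (hex : ∀ q, ex' q = (ex q).map (Prod.map id ev)) (x : Q ⊕ Q) :
    mstep tr a c ex' emb' x = (mstep tr a c ex emb x).map (Prod.map id ev) := by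
  cases x with
  | inr x => rfl
  | inl p =>
    rcases h : tr p a (some c) with _ | ⟨⟨p', act⟩, v⟩
    · simp [mstep, h]
    · cases act with
      | left =>
        simp only [mstep, h, hex]
        cases ex p' with
        | none => rfl
        | some e => simp [hev, hemb]
      | lift => simp [mstep, h, hemb]
      | right => simp [mstep, h]
      | drop => simp [mstep, h]

theorem subRun_eq {Q Cl Sy B O O' : Type} (tr : Tr Q Cl Sy B) (a : Sy) (c : Cl)
    (ex : Q → Option (Q × List O)) (ex' : Q → Option (Q × List O'))
    (emb : List B → List O) (emb' : List B → List O') (ev : List O → List O')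
    (hnil : ev [] = [])
    (hev : ∀ l l', ev (l ++ l') = ev l ++ ev l') (hemb : ∀ l, ev (emb l) = emb' l)
    (hex : ∀ q, ex' q = (ex q).map (Prod.map id ev)) (q : Q) :
    subRun tr a c ex' emb' q = (subRun tr a c ex emb q).map (Prod.map id ev) := by
  have h0 := mstep_eq tr a c ex ex' emb emb' ev hev hemb hex
  have h1 : nxOf (mstep tr a c ex' emb') = nxOf (mstep tr a c ex emb) := by
    funext x
    unfold nxOf
    rw [h0]
    cases mstep tr a c ex emb x <;> rfl
  have h2 : ∀ x, oOf (mstep tr a c ex' emb') x = ev (oOf (mstep tr a c ex emb) x) := by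
    intro x
    unfold oOf
    rw [h0]
    cases mstep tr a c ex emb x
    · exact hnil.symm
    · rfl
  unfold subRun
  rw [h1]
  rcases run (nxOf (mstep tr a c ex emb)) IsR (Sum.inl q) with _ | ⟨e, L⟩
  · rfl
  · cases e with
    | inl e => rfl
    | inr e =>
      simp only [Option.map_some, Prod.map, id]
      congr 2
      induction L with
      | nil => exact hnil.symm
      | cons x L ih => rw [List.flatMap_cons, List.flatMap_cons, hev, ih, h2]

theorem nstep_eq {Q Cl Sy B : Type} [Fintype Q] (tr : Tr Q Cl Sy B) (a : Sy) (n : ℕ)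
    (g : Sys Q B) (low : Option (Sys Q B)) (q : Q) :
    nstep tr a (low.map (fun g => exc g n)) id q =
      (fnode tr a (low.map (fun g => rho g n)) q).map (Prod.map id (evalSubst (fval g low n))) := by
  unfold fnode nstep
  rcases h : tr q a none with _ | ⟨⟨p', act⟩, v⟩
  · rfl
  · cases act with
    | left => simp [evalSubst_inl]
    | right => simp [evalSubst_inl]
    | lift => rfl
    | drop c =>
      cases low with
      | none => rfl
      | some g' =>
        simp only [Option.map_some]
        rw [subRun_eq tr a c (fex B false (rho g' n)) (exc g' n) (List.map Sum.inl) id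
          (evalSubst (fval g (some g') n)) rfl (evalSubst_append _) (evalSubst_inl _)
          (exc_eq g' n false _ (fun U => rfl))]
        cases subRun tr a c (fex B false (rho g' n)) (List.map Sum.inl) p' with
        | none => rfl
        | some p => simp [evalSubst_append, evalSubst_inl]

/-! ### Position bookkeeping -/

theorem gs_nx_pos {Q Cl Sy B : Type} {tr : Tr Q Cl Sy B} {τ : ℕ → Sy}
    {low : Option (Sys Q B)} {c c' : Q × ℕ} (h : (gs tr τ low).nx c = some c') :
    c'.2 ≤ c.2 + 1 := by
  unfold gs at h
  simp only at h
  split at h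
  · split at h
    · cases h
    · next hj => cases h; simp; omega
  · cases h; simp
  · cases h; simp
  · cases h

theorem gs_path_pos {Q Cl Sy B : Type} {tr : Tr Q Cl Sy B} {τ : ℕ → Sy}
    {low : Option (Sys Q B)} {n : ℕ} {c e : Q × ℕ} {L : List (Q × ℕ)}
    (h : Path (gs tr τ low).nx (fun c => n ≤ c.2) c L e) (hc : c.2 ≤ n) : e.2 = n := by
  induction h with
  | nil h => omega
  | cons h1 h2 _ ih =>
    have := gs_nx_pos h2
    exact ih (by omega)

theorem vis_pos {Q Cl Sy B : Type} {tr : Tr Q Cl Sy B} {τ : ℕ → Sy}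
    {low : Option (Sys Q B)} {n : ℕ} {q : Q} {e : Q × ℕ} {L : List (Q × ℕ)}
    (h : vis (gs tr τ low) n q = some (e, L)) : e.2 = n := by
  cases n with
  | zero => simp [vis] at h
  | succ n =>
    exact gs_path_pos (run_eq_some.1 h) (by simp)

/-! ### One level of the construction -/

noncomputable def fex2 {Q Cl Sy B : Type} [Fintype Q] (tr : Tr Q Cl Sy B) (a : Sy)
    (low : Option (Q → Option Q)) (g : Sys Q B) (n : ℕ) : Q ⊕ Q → List (Q × ℕ)
  | Sum.inl p => (p, n) ::
    (match fnode tr a low p with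
    | some (NRes.left q', _) => LLn g n q'
    | _ => [])
  | Sum.inr _ => []

theorem gs_nx_eq {Q Cl Sy B : Type} [Fintype Q] (tr : Tr Q Cl Sy B) (τ : ℕ → Sy)
    (low : Option (Sys Q B)) (q : Q) (n : ℕ) :
    (gs tr τ low).nx (q, n) =
      match fnode tr (τ n) (low.map (fun g => rho g n)) q with
      | some (NRes.left q', _) => (match n with | 0 => none | j + 1 => some (q', j))
      | some (NRes.right q', _) => some (q', n + 1)
      | some (NRes.stay q', _) => some (q', n)
      | none => none := by
  unfold gs
  simp only
  rw [nstep_eq tr (τ n) n (gs tr τ low) low q]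
  rcases fnode tr (τ n) (low.map (fun g => rho g n)) q with _ | ⟨r, v⟩
  · rfl
  · cases r <;> rfl

theorem path_of_formal {Q Cl Sy B : Type} [Fintype Q] (tr : Tr Q Cl Sy B) (τ : ℕ → Sy)
    (low : Option (Sys Q B)) (n : ℕ) {x y : Q ⊕ Q} {L : List (Q ⊕ Q)}
    (h : Path (fnx tr (τ n) (rho (gs tr τ low) n) (low.map (fun g => rho g n))) IsR x L y) :
    ∃ e, y = Sum.inr e ∧ (∀ q, x = Sum.inl q →
      Path (gs tr τ low).nx (fun c => n + 1 ≤ c.2) (q, n)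
        (L.flatMap (fex2 tr (τ n) (low.map (fun g => rho g n)) (gs tr τ low) n)) (e, n + 1)) ∧
      (∀ q, x = Sum.inr q → L = [] ∧ q = e) := by
  induction h with
  | @nil c h =>
    cases c with
    | inl c => simp [IsR] at h
    | inr c => exact ⟨c, rfl, by simp, by simp⟩
  | @cons c c' L e h1 h2 h3 ih =>
    cases c with
    | inr c => simp [IsR] at h1
    | inl q =>
      obtain ⟨e', rfl, ih1, ih2⟩ := ih
      refine ⟨e', rfl, ?_, by simp⟩
      rintro _ ⟨rfl⟩
      rw [List.flatMap_cons]
      have hg := gs_nx_eq tr τ low q n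
      unfold fnx at h2
      unfold fex2
      rcases hf : fnode tr (τ n) (low.map (fun g => rho g n)) q with _ | ⟨r, v⟩
      · simp [hf] at h2
      · cases r with
        | left q' =>
          simp only [hf] at h2 hg ⊢
          rw [List.cons_append]
          cases hv : vis (gs tr τ low) n q' with
          | none => simp [rho, hv] at h2
          | some p =>
            obtain ⟨⟨e1, m⟩, L1⟩ := p
            have hm := vis_pos hv
            simp only at hm
            subst hm
            simp [rho, hv] at h2
            cases m with
            | zero => simp [vis] at hv
            | succ m =>
              refine Path.cons (by simp) hg ?_
              have hL : LLn (gs tr τ low) (m + 1) q' = L1 := by simp [LLn, hv]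
              rw [hL]
              exact Path.append (fun c hc => by omega) (run_eq_some.1 hv) (ih1 e1 h2.symm)
        | right q' =>
          simp only [hf] at h2 hg ⊢
          obtain ⟨rfl⟩ := h2
          obtain ⟨rfl, rfl⟩ := ih2 q' rfl
          exact Path.cons (by simp) hg (Path.nil (by simp))
        | stay q' =>
          simp only [hf] at h2 hg ⊢
          obtain ⟨rfl⟩ := h2
          exact Path.cons (by simp) hg (ih1 q' rfl)

theorem formal_of_path {Q Cl Sy B : Type} [Fintype Q] (tr : Tr Q Cl Sy B) (τ : ℕ → Sy)
    (low : Option (Sys Q B)) (n : ℕ) : ∀ (N : ℕ) (L : List (Q × ℕ)), L.length ≤ N →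
    ∀ (q : Q) (e : Q × ℕ), Path (gs tr τ low).nx (fun c => n + 1 ≤ c.2) (q, n) L e →
    ∃ L' y, Path (fnx tr (τ n) (rho (gs tr τ low) n) (low.map (fun g => rho g n))) IsR
      (Sum.inl q) L' y := by
  intro N
  induction N with
  | zero =>
    intro L hL q e h
    cases h with
    | nil h => simp at h
    | cons => simp at hL
  | succ N ih =>
    intro L hL q e h
    cases h with
    | nil h => simp at h
    | @cons _ c' L' _ h1 h2 h3 =>
      simp only [List.length_cons, Nat.add_le_add_iff_right] at hL
      rw [gs_nx_eq tr τ low q n] at h2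
      rcases hf : fnode tr (τ n) (low.map (fun g => rho g n)) q with _ | ⟨r, v⟩
      · simp [hf] at h2
      · cases r with
        | left q' =>
          simp only [hf] at h2
          cases n with
          | zero => simp at h2
          | succ m =>
            simp only [Option.some.injEq] at h2
            subst h2
            obtain ⟨L1, e1, L2, p1, p2, rfl⟩ :=
              Path.split (E := fun c => m + 1 ≤ c.2) (fun c hc => by omega) h3
            have hp := gs_path_pos p1 (by simp)
            obtain ⟨q1, m1⟩ := e1
            simp only at hp
            subst hp
            obtain ⟨L', y, hy⟩ := ih L2 (by simp at hL; omega) q1 e p2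
            refine ⟨Sum.inl q :: L', y, Path.cons (by simp [IsR]) ?_ hy⟩
            have hv : vis (gs tr τ low) (m + 1) q' = some ((q1, m + 1), L1) := run_eq_some.2 p1
            simp [fnx, hf, rho, hv]
        | right q' =>
          refine ⟨[Sum.inl q], Sum.inr q', Path.cons (by simp [IsR]) ?_ (Path.nil (by simp [IsR]))⟩
          simp [fnx, hf]
        | stay q' =>
          simp only [hf, Option.some.injEq] at h2
          subst h2
          obtain ⟨L'', y, hy⟩ := ih L' hL q' e h3
          refine ⟨Sum.inl q :: L'', y, Path.cons (by simp [IsR]) ?_ hy⟩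
          simp [fnx, hf]

theorem vis_succ {Q Cl Sy B : Type} [Fintype Q] (tr : Tr Q Cl Sy B) (τ : ℕ → Sy)
    (low : Option (Sys Q B)) (n : ℕ) (q : Q) :
    vis (gs tr τ low) (n + 1) q =
      (run (fnx tr (τ n) (rho (gs tr τ low) n) (low.map (fun g => rho g n))) IsR (Sum.inl q)).map
      (fun p => ((Sum.elim id id p.1, n + 1),
        p.2.flatMap (fex2 tr (τ n) (low.map (fun g => rho g n)) (gs tr τ low) n))) := by
  refine run_congr (fun y => (Sum.elim id id y, n + 1))
    (fun L => L.flatMap (fex2 tr (τ n) (low.map (fun g => rho g n)) (gs tr τ low) n)) ?_ ?_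
  · intro L y h
    obtain ⟨e, rfl, h1, -⟩ := path_of_formal tr τ low n h
    exact h1 q rfl
  · intro L e h
    exact formal_of_path tr τ low n _ L le_rfl q e h

theorem rho_succ {Q Cl Sy B : Type} [Fintype Q] (tr : Tr Q Cl Sy B) (τ : ℕ → Sy)
    (low : Option (Sys Q B)) (n : ℕ) (q : Q) :
    rho (gs tr τ low) (n + 1) q =
      fexit tr (τ n) (rho (gs tr τ low) n) (low.map (fun g => rho g n)) q := by
  unfold rho fexit
  rw [vis_succ]
  rcases h : run (fnx tr (τ n) (rho (gs tr τ low) n) (low.map (fun g => rho g n))) IsR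
    (Sum.inl q) with _ | ⟨y, L⟩
  · unfold rho at h; simp [h]
  · obtain ⟨e, rfl, -⟩ := path_of_formal tr τ low n (run_eq_some.1 h)
    unfold rho at h; simp [h]

/-- Semantics of formal atoms. -/
noncomputable def aval {Q B : Type} [Fintype Q] (g : Sys Q B) (n : ℕ) :
    Q ⊕ Finset Q → List (Q × ℕ)
  | Sum.inl p => [(p, n)]
  | Sum.inr U => block (LLn g n) U

theorem LLn_pos {Q B : Type} {g : Sys Q B} {n : ℕ} {q : Q} {x : Q × ℕ}
    (h : x ∈ LLn g n q) : x.2 < n := by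
  have key : ∀ {c e L}, Path g.nx (fun c => n ≤ c.2) c L e → ∀ x ∈ L, x.2 < n := by
    intro c e L h
    induction h with
    | nil _ => simp
    | cons h1 _ _ ih =>
      intro x hx
      rcases List.mem_cons.1 hx with rfl | hx
      · omega
      · exact ih x hx
  unfold LLn at h
  cases n with
  | zero => simp [vis] at h
  | succ n =>
    cases hv : vis g (n + 1) q with
    | none => simp [hv] at h
    | some p =>
      rw [hv] at h
      exact key (run_eq_some.1 hv) x h

theorem block_mem {Q C : Type} [Fintype Q] {LL : Q → List C} {U : Finset Q} {x : C}
    (hx : x ∈ block LL U) : ∃ q, x ∈ LL q := by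
  unfold block at hx
  split_ifs at hx with h
  · exact ⟨_, (List.mem_filter.1 hx).1⟩
  · simp at hx

theorem LLn_succ {Q Cl Sy B : Type} [Fintype Q] (tr : Tr Q Cl Sy B) (τ : ℕ → Sy)
    (low : Option (Sys Q B)) (n : ℕ) (q : Q) :
    LLn (gs tr τ low) (n + 1) q =
      (fatoms tr (τ n) (rho (gs tr τ low) n) (low.map (fun g => rho g n)) q).flatMap
        (aval (gs tr τ low) n) := by
  have key : ∀ x, fex2 tr (τ n) (low.map (fun g => rho g n)) (gs tr τ low) n x =
      (fat tr (τ n) (low.map (fun g => rho g n)) x).flatMap (aval (gs tr τ low) n) := by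
    intro x
    cases x with
    | inr x => rfl
    | inl p =>
      rcases hf : fnode tr (τ n) (low.map (fun g => rho g n)) p with _ | ⟨r, v⟩
      · simp [fex2, fat, hf, aval]
      · cases r with
        | left q' =>
          simp only [fex2, fat, hf, List.flatMap_cons]
          rw [(SS_LLn (gs tr τ low) n).decomp q', List.flatMap_map]
          rfl
        | right => simp [fex2, fat, hf, aval]
        | stay => simp [fex2, fat, hf, aval]
  unfold LLn fatoms
  rw [vis_succ]
  rcases h : run (fnx tr (τ n) (rho (gs tr τ low) n) (low.map (fun g => rho g n))) IsR
    (Sum.inl q) with _ | ⟨y, L⟩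
  · rfl
  · simp only [Option.map_some]
    rw [List.flatMap_assoc]
    exact List.flatMap_congr (fun x _ => key x)

theorem valn_succ {Q Cl Sy B : Type} [Fintype Q] (tr : Tr Q Cl Sy B) (τ : ℕ → Sy)
    (low : Option (Sys Q B)) (n : ℕ) (V : Finset Q) :
    valn (gs tr τ low) (n + 1) V =
      evalSubst (fval (gs tr τ low) low n)
        (upd tr (τ n) (rho (gs tr τ low) n) (low.map (fun g => rho g n)) V) := by
  unfold valn upd
  rw [block_fupd (SS_LLn (gs tr τ low) (n + 1)) _ (aval (gs tr τ low) n)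
    (LLn_succ tr τ low n), List.flatMap_assoc, evalSubst_flatMap]
  · refine List.flatMap_congr ?_
    intro α _
    cases α with
    | inl p =>
      simp only [aval, List.flatMap_cons, List.flatMap_nil, List.append_nil, flet]
      unfold gs
      simp only
      rw [nstep_eq tr (τ n) n (gs tr τ low) low p]
      cases fnode tr (τ n) (low.map (fun g => rho g n)) p <;> rfl
    | inr U =>
      simp [aval, flet, evalSubst, fval, valn]
  · intro α β x hα hβ
    cases α with
    | inl p =>
      cases β with
      | inl p' => simp only [aval, List.mem_singleton] at hα hβ; rw [hα] at hβ; simp at hβ; rw [hβ]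
      | inr U =>
        simp only [aval, List.mem_singleton] at hα hβ
        obtain ⟨q, hq⟩ := block_mem hβ
        have := LLn_pos hq
        rw [hα] at this
        simp at this
    | inr U =>
      cases β with
      | inl p =>
        simp only [aval, List.mem_singleton] at hα hβ
        obtain ⟨q, hq⟩ := block_mem hα
        have := LLn_pos hq
        rw [hβ] at this
        simp at this
      | inr U' =>
        simp only [aval] at hα hβ
        rw [← block_sub hα, ← block_sub hβ]

theorem rho_zero {Q B : Type} (g : Sys Q B) : rho g 0 = fun _ => none := by
  funext q; rfl

theorem valn_zero {Q B : Type} [Fintype Q] (g : Sys Q B) (U : Finset Q) : valn g 0 U = [] := by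
  have : block (LLn g 0) U = [] := by
    unfold block
    split_ifs <;> simp [LLn, vis]
  simp [valn, this]

end MS

namespace MS

open Classical

/-! ### The SST of a layered system -/

def prd {k : ℕ} (l : Fin (k + 1)) : Fin (k + 1) := ⟨l.1 - 1, by omega⟩

noncomputable def lowst {k : ℕ} {S : Type} (st : Fin (k + 1) → S) (l : Fin (k + 1)) : Option S :=
  if l.1 = 0 then none else some (st (prd l))

def rg {k : ℕ} {Q : Type} (l : Fin (k + 1)) (x : Bool × Finset Q) : Fin (k + 1) × Finset Q :=
  (if x.1 then l else prd l, x.2)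

noncomputable def stp {Q Cl Sy B : Type} [Fintype Q] {k : ℕ} (tr : Tr Q Cl Sy B) (a : Sy)
    (st : Fin (k + 1) → Q → Option Q) : Fin (k + 1) → Q → Option Q :=
  fun l => fexit tr a (st l) (lowst st l)

noncomputable def supd {Q Cl Sy B : Type} [Fintype Q] {k : ℕ} (tr : Tr Q Cl Sy B) (a : Sy)
    (st : Fin (k + 1) → Q → Option Q) (x : Fin (k + 1) × Finset Q) :
    List (B ⊕ (Fin (k + 1) × Finset Q)) :=
  (upd tr a (st x.1) (lowst st x.1) x.2).map (Sum.map id (rg x.1))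

noncomputable def sem {Q Cl Sy B : Type} (k : ℕ) (tr : Tr Q Cl Sy B) (τ : ℕ → Sy) (n : ℕ) :
    Fin (k + 1) → Q → Option Q :=
  fun l => rho (gsys tr τ l) n

noncomputable def semv {Q Cl Sy B : Type} [Fintype Q] (k : ℕ) (tr : Tr Q Cl Sy B) (τ : ℕ → Sy)
    (n : ℕ) : Fin (k + 1) × Finset Q → List B :=
  fun x => valn (gsys tr τ x.1) n x.2

noncomputable def lowsys {Q Cl Sy B : Type} (tr : Tr Q Cl Sy B) (τ : ℕ → Sy) (l : ℕ) :
    Option (Sys Q B) := if l = 0 then none else some (gsys tr τ (l - 1))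

theorem gsys_eq {Q Cl Sy B : Type} (tr : Tr Q Cl Sy B) (τ : ℕ → Sy) (l : ℕ) :
    gsys tr τ l = gs tr τ (lowsys tr τ l) := by
  cases l <;> rfl

theorem lowsys_map {Q Cl Sy B : Type} (k : ℕ) (tr : Tr Q Cl Sy B) (τ : ℕ → Sy) (n : ℕ)
    (l : Fin (k + 1)) :
    (lowsys tr τ l).map (fun g => rho g n) = lowst (sem k tr τ n) l := by
  unfold lowsys lowst
  split_ifs <;> rfl

theorem sem_succ {Q Cl Sy B : Type} [Fintype Q] (k : ℕ) (tr : Tr Q Cl Sy B) (τ : ℕ → Sy) (n : ℕ) :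
    sem k tr τ (n + 1) = stp tr (τ n) (sem k tr τ n) := by
  funext l q
  unfold stp
  rw [← lowsys_map]
  unfold sem
  rw [gsys_eq, rho_succ]

theorem nstep_mem {Q Cl Sy B O : Type} (P : O → Prop) (tr : Tr Q Cl Sy B) (a : Sy)
    (low : Option (Q → Option (Q × List O))) (emb : List B → List O)
    (hemb : ∀ v, ∀ x ∈ emb v, P x)
    (hex : ∀ ex, low = some ex → ∀ q e, ex q = some e → ∀ x ∈ e.2, P x) (q : Q)
    (r : NRes Q × List O) (h : nstep tr a low emb q = some r) : ∀ x ∈ r.2, P x := by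
  rcases ht : tr q a none with _ | ⟨⟨q', act⟩, v⟩
  · simp [nstep, ht] at h
  · cases act with
    | left => simp [nstep, ht] at h; subst h; exact hemb v
    | right => simp [nstep, ht] at h; subst h; exact hemb v
    | lift => simp [nstep, ht] at h
    | drop c =>
      cases low with
      | none => simp [nstep, ht] at h
      | some ex =>
        have hm : ∀ y, ∀ x ∈ oOf (mstep tr a c ex emb) y, P x := by
          intro y x hx
          cases y with
          | inr y => simp [oOf, mstep] at hx
          | inl p =>
            rcases hp : tr p a (some c) with _ | ⟨⟨p', act⟩, u⟩
            · simp [oOf, mstep, hp] at hx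
            · cases act with
              | left =>
                cases he : ex p' with
                | none => simp [oOf, mstep, hp, he] at hx
                | some e =>
                  simp [oOf, mstep, hp, he] at hx
                  rcases hx with hx | hx
                  · exact hemb u x hx
                  · exact hex ex rfl p' e he x hx
              | lift => simp [oOf, mstep, hp] at hx; exact hemb u x hx
              | right => simp [oOf, mstep, hp] at hx
              | drop => simp [oOf, mstep, hp] at hx
        simp only [nstep, ht, Option.map_eq_some_iff] at h
        obtain ⟨p, hp, rfl⟩ := h
        unfold subRun at hp
        split at hp
        · cases hp
          intro x hx
          rcases List.mem_append.1 hx with hx | hx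
          · exact hemb v x hx
          · obtain ⟨y, -, hx⟩ := List.mem_flatMap.1 hx
            exact hm y x hx
        · cases hp

theorem flet_inl_mem {Q Cl Sy B : Type} [Fintype Q] (tr : Tr Q Cl Sy B) (a : Sy)
    (low : Option (Q → Option Q)) (p : Q) (t : Bool) (U : Finset Q)
    (h : Sum.inr (t, U) ∈ flet tr a low (Sum.inl p)) : t = false ∧ low ≠ none := by
  unfold flet at h
  cases hf : fnode tr a low p with
  | none => simp [hf] at h
  | some r =>
    simp [hf] at h
    refine nstep_mem (fun x => ∀ t U, x = Sum.inr (t, U) → t = false ∧ low ≠ none) tr a _ _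
      ?_ ?_ p r hf _ h t U rfl
    · intro v x hx t U hxt
      subst hxt
      simp at hx
    · intro ex hlow q e he x hx t U hxt
      subst hxt
      cases low with
      | none => simp at hlow
      | some r' =>
        simp at hlow
        subst hlow
        simp [fex] at he
        obtain ⟨e', -, rfl⟩ := he
        simp [wd] at hx
        simp [hx.2]

theorem upd_mem_low {Q Cl Sy B : Type} [Fintype Q] (tr : Tr Q Cl Sy B) (a : Sy)
    (r : Q → Option Q) (low : Option (Q → Option Q)) (V U : Finset Q)
    (h : Sum.inr (false, U) ∈ upd tr a r low V) : low ≠ none := by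
  unfold upd at h
  obtain ⟨α, -, h⟩ := List.mem_flatMap.1 h
  cases α with
  | inl p => exact (flet_inl_mem tr a low p _ _ h).2
  | inr W => simp [flet] at h

theorem countP_nodup {F : Type} (x : F) (l : List F) (h : l.Nodup) :
    l.countP (fun c => @decide (c = x) (Classical.propDecidable _)) ≤ 1 := by
  induction l with
  | nil => simp
  | cons a l ih =>
    rw [List.nodup_cons] at h
    rw [List.countP_cons]
    split_ifs with ha
    · have h0 : l.countP (fun c => @decide (c = x) (Classical.propDecidable _)) = 0 := by
        rw [List.countP_eq_zero]
        intro b hb hbx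
        have e1 := of_decide_eq_true ha
        have e2 := of_decide_eq_true hbx
        exact h.1 (e1.trans e2.symm ▸ hb)
      omega
    · exact ih h.2

theorem upd_count {Q Cl Sy B : Type} [Fintype Q] (tr : Tr Q Cl Sy B) (a : Sy)
    (r : Q → Option Q) (low : Option (Q → Option Q)) (V U : Finset Q) :
    occCount (true, U) (upd tr a r low V) ≤
      if V = supp (fatoms tr a r low) (Sum.inr U) then 1 else 0 := by
  have h1 : occCount (true, U) (upd tr a r low V) ≤
      (fupd (fatoms tr a r low) V).countP
        (fun c => @decide (c = Sum.inr U) (Classical.propDecidable _)) := by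
    unfold upd occCount
    generalize fupd (fatoms tr a r low) V = l
    induction l with
    | nil => simp
    | cons α l ih =>
      rw [List.flatMap_cons, List.countP_append, List.countP_cons]
      have : (flet tr a low α).countP (fun c => @decide (c = Sum.inr (true, U))
          (Classical.propDecidable _)) ≤
          if (@decide (α = Sum.inr U) (Classical.propDecidable _)) = true then 1 else 0 := by
        cases α with
        | inl p =>
          have : (flet tr a low (Sum.inl p)).countP (fun c => @decide (c = Sum.inr (true, U))
            (Classical.propDecidable _)) = 0 := by
            rw [List.countP_eq_zero]
            intro x hx hd
            have hd := @of_decide_eq_true _ (Classical.propDecidable _) hd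
            subst hd
            exact absurd (flet_inl_mem tr a low p _ _ hx).1 (by simp)
          rw [this]
          exact Nat.zero_le _
        | inr W =>
          by_cases hW : W = U <;> simp [flet, List.countP_cons, hW]
      omega
  refine h1.trans ?_
  split_ifs with hV
  · exact countP_nodup _ _ (fupd_nodup _ _)
  · rw [Nat.le_zero, List.countP_eq_zero]
    intro x hx h
    have h := @of_decide_eq_true _ (Classical.propDecidable _) h
    subst h
    exact hV (mem_fupd hx).symm

theorem semv_succ {Q Cl Sy B : Type} [Fintype Q] (k : ℕ) (tr : Tr Q Cl Sy B) (τ : ℕ → Sy) (n : ℕ) :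
    semv k tr τ (n + 1) = fun x => evalSubst (semv k tr τ n) (supd tr (τ n) (sem k tr τ n) x) := by
  funext x
  obtain ⟨l, V⟩ := x
  unfold supd
  rw [← lowsys_map]
  simp only [semv, sem]
  rw [gsys_eq, valn_succ]
  unfold evalSubst
  rw [List.flatMap_map]
  refine List.flatMap_congr ?_
  intro y hy
  cases y with
  | inl b => rfl
  | inr y =>
    obtain ⟨t, U⟩ := y
    cases t with
    | true => simp [fval, rg, semv, ← gsys_eq]
    | false =>
      by_cases hl : l.1 = 0
      · exact absurd (by simp [lowsys, hl]) (upd_mem_low _ _ _ _ _ _ hy)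
      · simp [fval, rg, lowsys, prd, semv, hl]

theorem supd_layer {Q Cl Sy B : Type} [Fintype Q] {k : ℕ} (tr : Tr Q Cl Sy B) (a : Sy)
    (st : Fin (k + 1) → Q → Option Q) (x y : Fin (k + 1) × Finset Q)
    (h : Sum.inr y ∈ supd tr a st x) : y.1 ≤ x.1 := by
  unfold supd at h
  simp only [List.mem_map] at h
  obtain ⟨z, -, hz⟩ := h
  cases z with
  | inl b => simp at hz
  | inr z =>
    simp at hz
    subst hz
    unfold rg
    split_ifs
    · exact le_rfl
    · rw [Fin.le_def]; simp [prd]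

theorem supd_count {Q Cl Sy B : Type} [Fintype Q] {k : ℕ} (tr : Tr Q Cl Sy B) (a : Sy)
    (st : Fin (k + 1) → Q → Option Q) (l : Fin (k + 1)) (V U : Finset Q) :
    occCount (l, U) (supd tr a st (l, V)) ≤ occCount (true, U) (upd tr a (st l) (lowst st l) V) := by
  unfold supd occCount
  rw [List.countP_map]
  refine List.countP_mono_left ?_
  intro x hx h
  simp only [Function.comp, decide_eq_true_eq] at h ⊢
  cases x with
  | inl b => simp at h
  | inr z =>
    obtain ⟨t, W⟩ := z
    cases t with
    | true => simp [rg] at h; simp [h]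
    | false =>
      have := upd_mem_low _ _ _ _ _ _ hx
      simp [rg, prd, Fin.ext_iff] at h
      have hl : l.1 = 0 := by omega
      simp [lowst, hl] at this

theorem supd_sum {Q Cl Sy B : Type} [Fintype Q] {k : ℕ} (tr : Tr Q Cl Sy B) (a : Sy)
    (st : Fin (k + 1) → Q → Option Q) (y : Fin (k + 1) × Finset Q)
    (s : Finset (Fin (k + 1) × Finset Q)) (hs : ∀ x ∈ s, x.1 = y.1) :
    (∑ x ∈ s, occCount y (supd tr a st x)) ≤ 1 := by
  obtain ⟨l, U⟩ := y
  have h1 : ∀ x ∈ s, occCount (l, U) (supd tr a st x) ≤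
      if x = (l, supp (fatoms tr a (st l) (lowst st l)) (Sum.inr U)) then 1 else 0 := by
    rintro ⟨l', V⟩ hx
    have := hs _ hx
    simp only at this
    subst this
    refine (supd_count tr a st l' V U).trans ((upd_count tr a _ _ V U).trans ?_)
    simp
  refine (Finset.sum_le_sum h1).trans ?_
  rw [Finset.sum_ite_eq']
  split_ifs <;> simp

theorem eval_apply {B X : Type} (v : X → List B) (s : X → List (B ⊕ X)) (l : List (B ⊕ X)) :
    evalSubst v (applySubst s l) = evalSubst (fun x => evalSubst v (s x)) l := by
  unfold evalSubst applySubst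
  rw [List.flatMap_assoc]
  refine List.flatMap_congr ?_
  intro x _
  cases x <;> simp

/-- The SST simulating the layered system. -/
noncomputable def theSST {A B Q Cl : Type} [Fintype Q] (k : ℕ) (tr : Tr Q Cl (TapeSym A) B)
    (qs : Q) : SST A B where
  Q := Fin (k + 1) → Q → Option Q
  X := Fin (k + 1) × Finset Q
  finQ := Fintype.ofFinite _
  finX := Fintype.ofFinite _
  q0 := stp tr TapeSym.lend (fun _ _ => none)
  init := fun x => evalSubst (fun _ => []) (supd tr TapeSym.lend (fun _ _ => none) x)
  trans := fun st a => some (stp tr (TapeSym.letter a) st, supd tr (TapeSym.letter a) st)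
  out := fun st => (stp tr TapeSym.rend st (Fin.last k) qs).map (fun _ =>
    applySubst (supd tr TapeSym.rend st) ((wd B true qs).map (Sum.map id (rg (Fin.last k)))))

theorem theSST_layered {A B Q Cl : Type} [Fintype Q] (k : ℕ) (tr : Tr Q Cl (TapeSym A) B)
    (qs : Q) : (theSST k tr qs).IsLayered k := by
  refine ⟨fun x : Fin (k + 1) × Finset Q => x.1, ?_⟩
  intro st a p hp
  obtain rfl : (stp tr (TapeSym.letter a) st, supd tr (TapeSym.letter a) st) = p :=
    Option.some.inj hp
  constructor
  · intro x y h
    exact supd_layer tr _ st x y h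
  · intro y
    refine supd_sum tr _ st y _ ?_
    intro x hx
    exact (Finset.mem_filter.1 hx).2

theorem tapeAt_zero {A : Type} (w : List A) : tapeAt w 0 = TapeSym.lend := rfl

theorem tapeAt_letter {A : Type} (w : List A) (m : ℕ) (h : m < w.length) :
    tapeAt w (m + 1) = TapeSym.letter w[m] := by
  simp [tapeAt, h]

theorem tapeAt_rend {A : Type} (w : List A) (m : ℕ) (h : w.length ≤ m) :
    tapeAt w (m + 1) = TapeSym.rend := by
  simp [tapeAt, h]

theorem theSST_run {A B Q Cl : Type} [Fintype Q] (k : ℕ) (tr : Tr Q Cl (TapeSym A) B)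
    (qs : Q) (w : List A) : ∀ (d m : ℕ), m + d = w.length →
    (theSST k tr qs).runFrom (sem k tr (tapeAt w) (m + 1)) (semv k tr (tapeAt w) (m + 1))
      (w.drop m) = some (sem k tr (tapeAt w) (w.length + 1),
        semv k tr (tapeAt w) (w.length + 1)) := by
  intro d
  induction d with
  | zero =>
    intro m hm
    have : m = w.length := by omega
    subst this
    rw [List.drop_length]
    rfl
  | succ d ih =>
    intro m hm
    rw [List.drop_eq_getElem_cons (by omega), ← ih (m + 1) (by omega)]
    rw [sem_succ k tr (tapeAt w) (m + 1), semv_succ k tr (tapeAt w) (m + 1),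
      tapeAt_letter w m (by omega)]
    rfl

theorem theSST_eval {A B Q Cl : Type} [Fintype Q] (k : ℕ) (tr : Tr Q Cl (TapeSym A) B)
    (qs : Q) (w : List A) : (theSST k tr qs).eval w =
      (exc (gsys tr (tapeAt w) k) (w.length + 2) qs).map Prod.snd := by
  have h0 : sem k tr (tapeAt w) 0 = fun _ _ => none := by
    funext l; exact rho_zero _
  have h0' : semv k tr (tapeAt w) 0 = fun _ => [] := by
    funext l; exact valn_zero _ _
  have hi : (theSST k tr qs).q0 = sem k tr (tapeAt w) (0 + 1) := by
    rw [sem_succ, h0]; rfl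
  have hi' : (theSST k tr qs).init = semv k tr (tapeAt w) (0 + 1) := by
    rw [semv_succ, h0, h0']; rfl
  have hr := theSST_run k tr qs w w.length 0 (by omega)
  rw [List.drop_zero] at hr
  unfold SST.eval
  rw [hi, hi', hr]
  have e1 := congrFun (congrFun (sem_succ k tr (tapeAt w) (w.length + 1)) (Fin.last k)) qs
  have e2 := semv_succ k tr (tapeAt w) (w.length + 1)
  rw [tapeAt_rend w w.length le_rfl] at e1 e2
  simp only [Option.bind_some, theSST, Option.map_map]
  rw [← e1]
  have e3 : evalSubst (semv k tr (tapeAt w) (w.length + 1))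
      (applySubst (supd tr TapeSym.rend (sem k tr (tapeAt w) (w.length + 1)))
        ((wd B true qs).map (Sum.map id (rg (Fin.last k))))) =
      (LLn (gsys tr (tapeAt w) k) (w.length + 2) qs).flatMap (gsys tr (tapeAt w) k).o := by
    rw [eval_apply, ← e2, ← eval_wd (gsys tr (tapeAt w) k) (w.length + 2) true
      (fun x => semv k tr (tapeAt w) (w.length + 2) (rg (Fin.last k) x)) (fun U => rfl)]
    unfold evalSubst
    rw [List.flatMap_map]
    refine List.flatMap_congr ?_
    intro x _
    cases x <;> rfl
  simp only [Function.comp_def, e3]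
  simp only [sem, rho, exc, Option.map_map, Fin.val_last]
  cases h : vis (gsys tr (tapeAt w) k) (w.length + 2) qs with
  | none => simp [h]
  | some p => simp [h, LLn]

end MS

namespace MS

open Classical

/-! ### From marble transducers to SSTs -/

theorem msteps_trans {A B : Type} {T : MarbleT A B} {w : List A}
    {c c' c'' : T.Q × ℕ × List (T.C × ℕ)} {u v : List B}
    (h : MarbleT.Steps T w c u c') (h' : MarbleT.Steps T w c' v c'') :
    MarbleT.Steps T w c (u ++ v) c'' := by
  induction h with
  | refl => exact h'
  | stepL h1 h2 _ ih => rw [List.append_assoc]; exact .stepL h1 h2 (ih h')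
  | stepR h1 h2 h3 _ ih => rw [List.append_assoc]; exact .stepR h1 h2 h3 (ih h')
  | stepLift h1 _ ih => rw [List.append_assoc]; exact .stepLift h1 (ih h')
  | stepDrop h1 h2 _ ih => rw [List.append_assoc]; exact .stepDrop h1 h2 (ih h')

def lft {Q C B : Type} (r : Option ((Q × MAct C) × List B)) :
    Option ((Option Q × MAct C) × List B) := r.map (fun p => ((some p.1.1, p.1.2), p.2))

noncomputable def mtr {A B : Type} (T : MarbleT A B) : Tr (Option T.Q) T.C (TapeSym A) B
  | none, _, some _ => none
  | none, TapeSym.lend, none => lft (T.trans T.q0 TapeSym.lend none)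
  | none, TapeSym.letter _, none => some ((none, MAct.left), [])
  | none, TapeSym.rend, none => some ((none, MAct.left), [])
  | some q, s, some c => lft (T.trans q s (some c))
  | some q, TapeSym.lend, none => lft (T.trans q TapeSym.lend none)
  | some q, TapeSym.letter a, none => lft (T.trans q (TapeSym.letter a) none)
  | some q, TapeSym.rend, none =>
    if q ∈ T.final then some ((some q, MAct.right), [])
    else match T.trans q TapeSym.rend none with
      | some ((_, MAct.right), _) => none
      | r => lft r

theorem mtr_acc {A B : Type} (T : MarbleT A B) (w : List A) (q : T.Q) (hq : q ∈ T.final) :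
    mtr T (some q) (tapeAt w (w.length + 1)) none = some ((some q, MAct.right), []) := by
  rw [tapeAt_rend w _ le_rfl]
  simp [mtr, hq]

theorem mtr_marked {A B : Type} (T : MarbleT A B) (s : TapeSym A) (q : T.Q) (c : T.C) :
    mtr T (some q) s (some c) = lft (T.trans q s (some c)) := by
  cases s <;> rfl

theorem tape_cases {A : Type} (w : List A) (j : ℕ) (h : j ≤ w.length) :
    tapeAt w j ≠ TapeSym.rend := by
  cases j with
  | zero => simp [tapeAt]
  | succ j => rw [tapeAt_letter w j (by omega)]; simp

/-- Transitions of `mtr` are transitions of the machine. -/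
theorem mtr_some {A B : Type} (T : MarbleT A B) (w : List A) (q : T.Q) (j : ℕ)
    (hj : j ≤ w.length + 1) (hna : ¬ (j = w.length + 1 ∧ q ∈ T.final))
    (r : (Option T.Q × MAct T.C) × List B)
    (h : mtr T (some q) (tapeAt w j) none = some r) :
    ∃ q' act v, r = ((some q', act), v) ∧ T.trans q (tapeAt w j) none = some ((q', act), v) ∧
      (act = MAct.right → j ≤ w.length) := by
  by_cases hl : j ≤ w.length
  · have hr := tape_cases w j hl
    have : lft (T.trans q (tapeAt w j) none) = some r := by
      generalize tapeAt w j = s at *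
      cases s with
      | lend => exact h
      | rend => exact absurd rfl hr
      | letter a => exact h
    simp only [lft, Option.map_eq_some_iff] at this
    obtain ⟨⟨⟨q', act⟩, v⟩, h1, rfl⟩ := this
    exact ⟨q', act, v, rfl, h1, fun _ => hl⟩
  · have hj' : j = w.length + 1 := by omega
    have hq : q ∉ T.final := fun hq => hna ⟨hj', hq⟩
    subst hj'
    rw [tapeAt_rend w _ le_rfl] at h ⊢
    simp only [mtr, hq, if_false] at h
    rcases ht : T.trans q TapeSym.rend none with _ | ⟨⟨q', act⟩, v⟩
    · simp [ht, lft] at h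
    · cases act <;> simp [ht, lft] at h <;> subst h <;> exact ⟨q', _, v, rfl, rfl, by simp⟩

theorem mtr_of {A B : Type} (T : MarbleT A B) (w : List A) (q : T.Q) (j : ℕ)
    (hj : j ≤ w.length + 1) (hna : ¬ (j = w.length + 1 ∧ q ∈ T.final))
    (q' : T.Q) (act : MAct T.C) (v : List B)
    (h : T.trans q (tapeAt w j) none = some ((q', act), v)) (ha : act = MAct.right → j ≤ w.length) :
    mtr T (some q) (tapeAt w j) none = some ((some q', act), v) := by
  by_cases hl : j ≤ w.length
  · have hr := tape_cases w j hl
    generalize tapeAt w j = s at *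
    cases s with
    | lend => simp [mtr, lft, h]
    | rend => exact absurd rfl hr
    | letter a => simp [mtr, lft, h]
  · have hj' : j = w.length + 1 := by omega
    have hq : q ∉ T.final := fun hq => hna ⟨hj', hq⟩
    subst hj'
    rw [tapeAt_rend w _ le_rfl] at h ⊢
    simp only [mtr, hq, if_false, h]
    cases act with
    | right => exact absurd (ha rfl) hl
    | left => rfl
    | lift => rfl
    | drop => rfl

/-- Next configuration after a macro step. -/
def nres {Q : Type} (j : ℕ) : NRes Q → Option (Q × ℕ)
  | NRes.left q' => (match j with | 0 => none | j + 1 => some (q', j))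
  | NRes.right q' => some (q', j + 1)
  | NRes.stay q' => some (q', j)

theorem gs_some {Q Cl Sy B : Type} {tr : Tr Q Cl Sy B} {τ : ℕ → Sy} {low : Option (Sys Q B)}
    {q : Q} {j : ℕ} {r : NRes Q} {v : List B}
    (h : nstep tr (τ j) (low.map (fun g => exc g j)) id q = some (r, v)) :
    (gs tr τ low).nx (q, j) = nres j r ∧ (gs tr τ low).o (q, j) = v := by
  unfold gs
  simp only [h]
  refine ⟨?_, rfl⟩
  cases r
  · cases j <;> rfl
  · rfl
  · rfl

theorem gs_inv {Q Cl Sy B : Type} {tr : Tr Q Cl Sy B} {τ : ℕ → Sy} {low : Option (Sys Q B)}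
    {q : Q} {j : ℕ} {c : Q × ℕ} (h : (gs tr τ low).nx (q, j) = some c) :
    ∃ r, nstep tr (τ j) (low.map (fun g => exc g j)) id q = some (r, (gs tr τ low).o (q, j)) ∧
      nres j r = some c := by
  cases hn : nstep tr (τ j) (low.map (fun g => exc g j)) id q with
  | none => simp [gs, hn] at h
  | some p =>
    obtain ⟨r, v⟩ := p
    obtain ⟨h1, h2⟩ := gs_some hn
    exact ⟨r, by rw [h2], by rw [← h1, h]⟩

section B
variable {A B : Type} (T : MarbleT A B) (w : List A)

/-- The run between drop and lift. -/
theorem sub_steps (g : Sys (Option T.Q) B) (j : ℕ) (hj : j ≤ w.length + 1)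
    (hg : ∀ i, i ≤ w.length + 1 → ∀ π, (∀ i' < i, marbleAt i' π = none) →
      ∀ q q' L, vis g i (some q) = some (q', L) → ∃ q'', q' = (some q'', i) ∧
        MarbleT.Steps T w (q, i - 1, π) (L.flatMap g.o) (q'', i, π)) (c : T.C)
    (π : List (T.C × ℕ)) :
    ∀ {x L y}, Path (nxOf (mstep (mtr T) (tapeAt w j) c (exc g j) id)) IsR x L y →
    ∀ q, x = Sum.inl (some q) → ∃ q', y = Sum.inr (some q') ∧
      MarbleT.Steps T w (q, j, (c, j) :: π)
        (L.flatMap (oOf (mstep (mtr T) (tapeAt w j) c (exc g j) id))) (q', j, π) := by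
  intro x L y h
  induction h with
  | nil h => rintro q rfl; simp [IsR] at h
  | @cons x x' L y h1 h2 h3 ih =>
    rintro q rfl
    have hma : marbleAt j ((c, j) :: π) = some c := by simp [marbleAt]
    rw [List.flatMap_cons]
    rcases ht : T.trans q (tapeAt w j) (some c) with _ | ⟨⟨q1, act⟩, v⟩
    · simp [nxOf, mstep, mtr_marked, ht, lft] at h2
    · have hl := T.marble_left_or_lift _ _ _ _ ht
      cases act with
      | right => simp at hl
      | drop => simp at hl
      | lift =>
        simp [nxOf, mstep, mtr_marked, ht, lft] at h2
        subst h2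
        cases h3 with
        | cons h => simp [IsR] at h
        | nil h =>
          refine ⟨q1, rfl, ?_⟩
          simp [oOf, mstep, mtr_marked, ht, lft]
          have := MarbleT.Steps.stepLift (π := π) ht (.refl _)
          simpa using this
      | left =>
        cases hv : vis g j (some q1) with
        | none => simp [nxOf, mstep, mtr_marked, ht, lft, exc, hv] at h2
        | some p =>
          obtain ⟨p, L1⟩ := p
          obtain ⟨q2, rfl, hs⟩ := hg j hj ((c, j) :: π) (by
            intro i' hi'
            simp [marbleAt]; omega) q1 p L1 hv
          simp [nxOf, mstep, mtr_marked, ht, lft, exc, hv] at h2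
          obtain ⟨q3, rfl, hs'⟩ := ih q2 h2.symm
          refine ⟨q3, rfl, ?_⟩
          have hj1 : 1 ≤ j := by
            cases j with
            | zero => simp [vis] at hv
            | succ => omega
          have ho : oOf (mstep (mtr T) (tapeAt w j) c (exc g j) id) (Sum.inl (some q)) =
              v ++ L1.flatMap g.o := by
            simp [oOf, mstep, mtr_marked, ht, lft, exc, hv]
          rw [ho, List.append_assoc]
          exact MarbleT.Steps.stepL (by rw [hma]; exact ht) hj1 (msteps_trans hs hs')

theorem nx_steps (l : ℕ) : ∀ (q : T.Q) (j : ℕ) (c' : Option T.Q × ℕ) (π : List (T.C × ℕ)),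
    j ≤ w.length + 1 → (∀ i ≤ j, marbleAt i π = none) → ¬ (j = w.length + 1 ∧ q ∈ T.final) →
    (gsys (mtr T) (tapeAt w) l).nx (some q, j) = some c' →
    ∃ q' j', c' = (some q', j') ∧ j' ≤ w.length + 1 ∧
      MarbleT.Steps T w (q, j, π) ((gsys (mtr T) (tapeAt w) l).o (some q, j)) (q', j', π) := by
  have path : ∀ l, (∀ (q : T.Q) (j : ℕ) (c' : Option T.Q × ℕ) (π : List (T.C × ℕ)),
      j ≤ w.length + 1 → (∀ i ≤ j, marbleAt i π = none) → ¬ (j = w.length + 1 ∧ q ∈ T.final) →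
      (gsys (mtr T) (tapeAt w) l).nx (some q, j) = some c' →
      ∃ q' j', c' = (some q', j') ∧ j' ≤ w.length + 1 ∧
        MarbleT.Steps T w (q, j, π) ((gsys (mtr T) (tapeAt w) l).o (some q, j)) (q', j', π)) →
      ∀ (i : ℕ) (_ : i ≤ w.length + 1) (π : List (T.C × ℕ)) (_ : ∀ i' < i, marbleAt i' π = none),
      ∀ {c L e}, Path (gsys (mtr T) (tapeAt w) l).nx (fun c => i ≤ c.2) c L e →
        ∀ q j, c = (some q, j) → ∃ q' j', e = (some q', j') ∧
          MarbleT.Steps T w (q, j, π) (L.flatMap (gsys (mtr T) (tapeAt w) l).o) (q', j', π) := by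
    intro l hl i hi π hπ c L e h
    induction h with
    | nil h => rintro q j rfl; exact ⟨q, j, rfl, .refl _⟩
    | @cons c c' L e h1 h2 h3 ih =>
      rintro q j rfl
      simp only [not_le] at h1
      obtain ⟨q', j', rfl, -, hs⟩ := hl q j c' π (by omega) (fun i' hi' => hπ i' (by omega))
        (by omega) h2
      obtain ⟨q2, j2, rfl, hs2⟩ := ih q' j' rfl
      refine ⟨q2, j2, rfl, ?_⟩
      rw [List.flatMap_cons]
      exact msteps_trans hs hs2
  induction l with
  | zero =>
    intro q j c' π hj hπ hna h
    obtain ⟨r, h1, h2⟩ := gs_inv (low := none) h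
    change _ = some (r, (gsys (mtr T) (tapeAt w) 0).o (some q, j)) at h1
    generalize (gsys (mtr T) (tapeAt w) 0).o (some q, j) = v at *
    unfold nstep at h1
    rcases ht : mtr T (some q) (tapeAt w j) none with _ | s
    · simp [ht] at h1
    · obtain ⟨q', act, v', rfl, h3, h4⟩ := mtr_some T w q j hj hna s ht
      cases act with
      | left =>
        simp [ht] at h1
        obtain ⟨rfl, rfl⟩ := h1
        cases j with
        | zero => simp [nres] at h2
        | succ j =>
          simp [nres] at h2
          refine ⟨q', j, h2.symm, by omega, ?_⟩
          have := MarbleT.Steps.stepL (π := π) (by rw [hπ _ le_rfl]; exact h3) (by omega) (.refl _)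
          simpa using this
      | right =>
        simp [ht] at h1
        obtain ⟨rfl, rfl⟩ := h1
        simp [nres] at h2
        refine ⟨q', j + 1, h2.symm, by have := h4 rfl; omega, ?_⟩
        have := MarbleT.Steps.stepR (π := π) (hπ _ le_rfl) h3 (h4 rfl) (.refl _)
        simpa using this
      | lift => simp [ht] at h1
      | drop => simp [ht] at h1
  | succ l ih =>
    intro q j c' π hj hπ hna h
    obtain ⟨r, h1, h2⟩ := gs_inv (low := some (gsys (mtr T) (tapeAt w) l)) h
    change _ = some (r, (gsys (mtr T) (tapeAt w) (l + 1)).o (some q, j)) at h1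
    generalize (gsys (mtr T) (tapeAt w) (l + 1)).o (some q, j) = v at *
    unfold nstep at h1
    rcases ht : mtr T (some q) (tapeAt w j) none with _ | s
    · simp [ht] at h1
    · obtain ⟨q', act, v', rfl, h3, h4⟩ := mtr_some T w q j hj hna s ht
      cases act with
      | left =>
        simp [ht] at h1
        obtain ⟨rfl, rfl⟩ := h1
        cases j with
        | zero => simp [nres] at h2
        | succ j =>
          simp [nres] at h2
          refine ⟨q', j, h2.symm, by omega, ?_⟩
          have := MarbleT.Steps.stepL (π := π) (by rw [hπ _ le_rfl]; exact h3) (by omega) (.refl _)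
          simpa using this
      | right =>
        simp [ht] at h1
        obtain ⟨rfl, rfl⟩ := h1
        simp [nres] at h2
        refine ⟨q', j + 1, h2.symm, by have := h4 rfl; omega, ?_⟩
        have := MarbleT.Steps.stepR (π := π) (hπ _ le_rfl) h3 (h4 rfl) (.refl _)
        simpa using this
      | lift => simp [ht] at h1
      | drop cc =>
        simp only [ht, Option.map_some, Option.map_eq_some_iff] at h1
        obtain ⟨⟨p, u⟩, hp, h1⟩ := h1
        simp at h1
        obtain ⟨rfl, rfl⟩ := h1
        unfold subRun at hp
        split at hp
        · next p' L hr =>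
          simp at hp
          obtain ⟨rfl, rfl⟩ := hp
          obtain ⟨q'', hq'', hs⟩ := sub_steps T w (gsys (mtr T) (tapeAt w) l) j hj (by
            intro i hi π hπ q q' L hv
            have hp := vis_pos (low := lowsys (mtr T) (tapeAt w) l) (by rw [← gsys_eq]; exact hv)
            cases i with
            | zero => simp [vis] at hv
            | succ i =>
              obtain ⟨q2, j2, rfl, h⟩ := path l ih (i + 1) hi π hπ (run_eq_some.1 hv) q i rfl
              simp at hp
              subst hp
              exact ⟨q2, rfl, h⟩) cc π (run_eq_some.1 hr) q' rfl
          simp at hq''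
          subst hq''
          simp [nres] at h2
          refine ⟨q'', j, h2.symm, hj, ?_⟩
          exact MarbleT.Steps.stepDrop (hπ _ le_rfl) h3 hs
        · cases hp

theorem acc_steps (k : ℕ) : ∀ {c L e},
    Path (gsys (mtr T) (tapeAt w) k).nx (fun c => w.length + 2 ≤ c.2) c L e →
    ∀ q j, c = (some q, j) → j ≤ w.length + 1 → ∃ qf ∈ T.final,
      MarbleT.Steps T w (q, j, []) (L.flatMap (gsys (mtr T) (tapeAt w) k).o)
        (qf, w.length + 1, []) := by
  intro c L e h
  induction h with
  | nil h => rintro q j rfl hj; simp at h; omega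
  | @cons c c' L e h1 h2 h3 ih =>
    rintro q j rfl hj
    by_cases hna : j = w.length + 1 ∧ q ∈ T.final
    · obtain ⟨rfl, hq⟩ := hna
      have : nstep (mtr T) (tapeAt w (w.length + 1))
        ((lowsys (mtr T) (tapeAt w) k).map (fun g => exc g (w.length + 1))) id (some q) =
        some (NRes.right (some q), []) := by simp [nstep, mtr_acc T w q hq]
      obtain ⟨e1, e2⟩ := gs_some this
      rw [← gsys_eq] at e1 e2
      rw [e1] at h2
      simp [nres] at h2
      subst h2
      cases h3 with
      | cons h => simp at h
      | nil h =>
        refine ⟨q, hq, ?_⟩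
        rw [List.flatMap_cons, e2]
        exact .refl _
    · obtain ⟨q', j', rfl, hj', hs⟩ := nx_steps T w k q j c' [] hj (by simp [marbleAt]) hna h2
      obtain ⟨qf, hqf, hs'⟩ := ih q' j' rfl hj'
      refine ⟨qf, hqf, ?_⟩
      rw [List.flatMap_cons]
      exact msteps_trans hs hs'


theorem none_zero (k : ℕ) : (gsys (mtr T) (tapeAt w) k).nx (none, 0) =
    (gsys (mtr T) (tapeAt w) k).nx (some T.q0, 0) ∧ (gsys (mtr T) (tapeAt w) k).o (none, 0) =
    (gsys (mtr T) (tapeAt w) k).o (some T.q0, 0) := by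
  have : nstep (mtr T) (tapeAt w 0)
        ((lowsys (mtr T) (tapeAt w) k).map (fun g => exc g 0)) id none =
        nstep (mtr T) (tapeAt w 0)
        ((lowsys (mtr T) (tapeAt w) k).map (fun g => exc g 0)) id (some T.q0) := by
    unfold nstep
    rw [tapeAt_zero]
    rfl
  rw [gsys_eq]
  unfold gs
  simp only [this]
  exact ⟨trivial, trivial⟩

theorem none_succ (k j : ℕ) : (gsys (mtr T) (tapeAt w) k).nx (none, j + 1) =
    some (none, j) ∧ (gsys (mtr T) (tapeAt w) k).o (none, j + 1) = [] := by
  have : nstep (mtr T) (tapeAt w (j + 1))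
        ((lowsys (mtr T) (tapeAt w) k).map (fun g => exc g (j + 1))) id none =
        some (NRes.left none, []) := by
    unfold nstep
    by_cases hj : j < w.length
    · rw [tapeAt_letter w j hj]; rfl
    · rw [tapeAt_rend w j (by omega)]; rfl
  obtain ⟨e1, e2⟩ := gs_some this
  rw [← gsys_eq] at e1 e2
  exact ⟨e1, e2⟩

theorem none_walk (k : ℕ) {L e}
    (h : Path (gsys (mtr T) (tapeAt w) k).nx (fun c => w.length + 2 ≤ c.2) (some T.q0, 0) L e) :
    ∀ j ≤ w.length + 1, ∃ L',
      Path (gsys (mtr T) (tapeAt w) k).nx (fun c => w.length + 2 ≤ c.2) (none, j) L' e ∧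
      L'.flatMap (gsys (mtr T) (tapeAt w) k).o = L.flatMap (gsys (mtr T) (tapeAt w) k).o := by
  intro j
  induction j with
  | zero =>
    intro _
    cases h with
    | nil h => simp at h
    | @cons c c' L e h1 h2 h3 =>
      obtain ⟨e1, e2⟩ := none_zero T w k
      refine ⟨_, Path.cons (by simp) (by rw [e1, h2]) h3, ?_⟩
      simp [e2]
  | succ j ih =>
    intro hj
    obtain ⟨L', h1, h2⟩ := ih (by omega)
    obtain ⟨e1, e2⟩ := none_succ T w k j
    refine ⟨_, Path.cons (by simp; omega) e1 h1, ?_⟩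
    rw [List.flatMap_cons, e2, h2, List.nil_append]

theorem none_walk' (k : ℕ) : ∀ j ≤ w.length + 1, ∀ L e,
      Path (gsys (mtr T) (tapeAt w) k).nx (fun c => w.length + 2 ≤ c.2) (none, j) L e →
      ∃ L', Path (gsys (mtr T) (tapeAt w) k).nx (fun c => w.length + 2 ≤ c.2)
        (some T.q0, 0) L' e := by
  intro j
  induction j with
  | zero =>
    intro _ L e h
    cases h with
    | nil h => simp at h
    | @cons c c' L e h1 h2 h3 =>
      obtain ⟨e1, e2⟩ := none_zero T w k
      exact ⟨_, Path.cons (by simp) (by rw [← e1, h2]) h3⟩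
  | succ j ih =>
    intro hj L e h
    obtain ⟨e1, e2⟩ := none_succ T w k j
    cases h with
    | nil h => simp at h; omega
    | @cons c c' L e h1 h2 h3 =>
      rw [e1] at h2
      cases h2
      exact ih (by omega) _ _ h3

/-! Completeness -/

def Inv {C : Type} (n : ℕ) : ℕ → List (C × ℕ) → Prop
  | m, [] => m ≤ n + 1
  | m, (_, i) :: π => m ≤ i ∧ Inv n i π

theorem Inv.mono {C : Type} {n m m' : ℕ} {π : List (C × ℕ)} (h : Inv n m π) (hm : m' ≤ m) :
    Inv n m' π := by
  cases π with
  | nil => exact le_trans hm h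
  | cons x π => exact ⟨le_trans hm h.1, h.2⟩

theorem Inv.le {C : Type} {n : ℕ} {π : List (C × ℕ)} : ∀ {m}, Inv n m π → m ≤ n + 1 := by
  induction π with
  | nil => intro m h; exact h
  | cons x π ih => intro m h; exact le_trans h.1 (ih h.2)

/-- The rest of the run is summarized by the layered systems. -/
def DD (k : ℕ) : List (T.C × ℕ) → Option T.Q → ℕ → Prop
  | [], q, j => ∃ L e, Path (gsys (mtr T) (tapeAt w) k).nx (fun c => w.length + 2 ≤ c.2) (q, j) L e
  | (c, i) :: π, q, j => ∃ p L,
      Path (gsys (mtr T) (tapeAt w) (k - (π.length + 1))).nx (fun c => i ≤ c.2) (q, j) L (p, i) ∧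
      ∃ L' p', Path (nxOf (mstep (mtr T) (tapeAt w i) c
        (exc (gsys (mtr T) (tapeAt w) (k - (π.length + 1))) i) id)) IsR (Sum.inl p) L'
        (Sum.inr p') ∧ DD k π p' i

def bd (n : ℕ) {C : Type} : List (C × ℕ) → ℕ
  | [] => n + 2
  | (_, i) :: _ => i

theorem DD_nx (k : ℕ) (π : List (T.C × ℕ)) (q q' : Option T.Q) (j j' : ℕ)
    (hj : j < bd w.length π)
    (h : (gsys (mtr T) (tapeAt w) (k - π.length)).nx (q, j) = some (q', j'))
    (hd : DD T w k π q' j') : DD T w k π q j := by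
  cases π with
  | nil =>
    obtain ⟨L, e, hp⟩ := hd
    exact ⟨_, e, Path.cons (by simpa [bd] using hj) h hp⟩
  | cons x π =>
    obtain ⟨p, L, hp, hr⟩ := hd
    exact ⟨p, _, Path.cons (by simpa [bd] using hj) h hp, hr⟩

theorem Inv.lt {C : Type} {n m : ℕ} {π : List (C × ℕ)} (h : Inv n m π)
    (hm : marbleAt m π = none) : m < bd n π := by
  cases π with
  | nil => have : m ≤ n + 1 := h
           simp only [bd]; omega
  | cons x π =>
    obtain ⟨c, i⟩ := x
    have h1 : m ≤ i := h.1
    simp [marbleAt] at hm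
    simp only [bd]; omega

theorem DD_acc (k : ℕ) (q : T.Q) (hq : q ∈ T.final) :
    DD T w k [] (some q) (w.length + 1) := by
  have : nstep (mtr T) (tapeAt w (w.length + 1))
    ((lowsys (mtr T) (tapeAt w) k).map (fun g => exc g (w.length + 1))) id (some q) =
    some (NRes.right (some q), []) := by simp [nstep, mtr_acc T w q hq]
  obtain ⟨e1, e2⟩ := gs_some this
  rw [← gsys_eq] at e1
  exact ⟨_, _, Path.cons (by simp) e1 (Path.nil (by simp))⟩

theorem DD_of_steps (k : ℕ) {cf c : T.Q × ℕ × List (T.C × ℕ)} {u : List B}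
    (h : MarbleT.Steps T w c u cf) :
    cf.1 ∈ T.final → cf.2 = (w.length + 1, []) →
    Inv w.length c.2.1 c.2.2 → (∀ u c', MarbleT.Steps T w c u c' → c'.2.2.length ≤ k) →
    DD T w k c.2.2 (some c.1) c.2.1 := by
  induction h with
  | refl c =>
    intro hf hc _ _
    obtain ⟨q, m⟩ := c
    simp only at hc hf
    subst hc
    exact DD_acc T w k q hf
  | @stepL q m π q' v u cf h1 h2 h3 ih =>
    intro hf hc hi hb
    have ih := ih hf hc (hi.mono (by simp)) (fun u c' h => hb _ c' (.stepL h1 h2 h))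
    simp only at hi ih ⊢
    cases hm : marbleAt m π with
    | none =>
      by_cases hna : m = w.length + 1 ∧ q ∈ T.final
      · obtain ⟨rfl, hq⟩ := hna
        have := hi.lt hm
        cases π with
        | nil => exact DD_acc T w k q hq
        | cons x π => have := hi.2.le; simp [bd] at *; omega
      · rw [hm] at h1
        have ht := mtr_of T w q m hi.le hna q' _ v h1 (by simp)
        refine DD_nx T w k π _ _ _ _ (hi.lt hm) ?_ ih
        rw [gsys_eq, (gs_some (r := NRes.left (some q')) (v := v) (by simp [nstep, ht])).1]
        cases m with
        | zero => omega
        | succ m => rfl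
    | some c =>
      cases π with
      | nil => simp [marbleAt] at hm
      | cons x π =>
        obtain ⟨c', i⟩ := x
        simp [marbleAt] at hm
        obtain ⟨rfl, rfl⟩ := hm
        simp only [marbleAt, if_true] at h1
        obtain ⟨p, L, hp, L', p', hp', hd⟩ := ih
        refine ⟨some q, [], Path.nil (by simp), Sum.inl (some q) :: L', p',
          Path.cons (by simp [IsR]) ?_ hp', hd⟩
        cases i with
        | zero => omega
        | succ i =>
          have hv : vis (gsys (mtr T) (tapeAt w) (k - (π.length + 1))) (i + 1) (some q') =
              some ((p, i + 1), L) := run_eq_some.2 hp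
          simp [nxOf, mstep, mtr_marked, lft, h1, exc, hv]
  | @stepR q m π q' v u cf hm h1 h2 h3 ih =>
    intro hf hc hi hb
    have hlt := hi.lt hm
    simp only at hlt
    have ih := ih hf hc (by
      cases π with
      | nil => simp only [Inv]; omega
      | cons x π => simp only [bd] at hlt; exact ⟨hlt, hi.2⟩)
        (fun u c' h => hb _ c' (.stepR hm h1 h2 h))
    simp only at hi ih ⊢
    have ht := mtr_of T w q m hi.le (by omega) q' _ v h1 (fun _ => h2)
    refine DD_nx T w k π _ _ _ _ hlt ?_ ih
    rw [gsys_eq, (gs_some (r := NRes.right (some q')) (v := v) (by simp [nstep, ht])).1]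
    rfl
  | @stepLift q m π q' cc v u cf h1 h3 ih =>
    intro hf hc hi hb
    have ih := ih hf hc hi.2 (fun u c' h => hb _ c' (.stepLift h1 h))
    simp only at hi ih ⊢
    refine ⟨some q, [], Path.nil (by simp), _, some q',
      Path.cons (by simp [IsR]) ?_ (Path.nil (by simp [IsR])), ih⟩
    simp [nxOf, mstep, mtr_marked, lft, h1]
  | @stepDrop q m π q' cc v u cf hm h1 h3 ih =>
    intro hf hc hi hb
    have hlt := hi.lt hm
    simp only at hlt
    have ih := ih hf hc ⟨le_rfl, hi⟩ (fun u c' h => hb _ c' (.stepDrop hm h1 h))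
    have hk := hb _ _ (.stepDrop hm h1 (.refl _))
    simp only [List.length_cons] at hi ih hk ⊢
    obtain ⟨p, L, hp, L', p', hp', hd⟩ := ih
    by_cases hna : m = w.length + 1 ∧ q ∈ T.final
    · obtain ⟨rfl, hq⟩ := hna
      cases π with
      | nil => exact DD_acc T w k q hq
      | cons x π => have := hi.2.le; simp [bd] at *; omega
    · have ht := mtr_of T w q m hi.le hna q' _ v h1 (by simp)
      refine DD_nx T w k π _ p' _ m hlt ?_ hd
      cases hp with
      | cons h => simp at h
      | nil _ =>
        obtain ⟨l, hl⟩ : ∃ l, k - π.length = l + 1 := ⟨k - π.length - 1, by omega⟩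
        have hl' : k - (π.length + 1) = l := by omega
        rw [hl'] at hp'
        rw [hl]
        have hr := run_eq_some.2 hp'
        refine (gs_some (low := some (gsys (mtr T) (tapeAt w) l)) (r := NRes.stay p')
          (v := v ++ L'.flatMap (oOf (mstep (mtr T) (tapeAt w m) cc
            (exc (gsys (mtr T) (tapeAt w) l) m) id))) ?_).1
        simp only [nstep, ht, Option.map_some, subRun, hr, id]

end B

theorem marble_to_sst {A B : Type} (k : ℕ) (f : List A → Option (List B)) (T : MarbleT A B)
    (hT : T.IsKMarble k) (hf : T.Computes f) :
    ∃ S : SST A B, S.IsLayered k ∧ S.Computes f := by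
  refine ⟨theSST k (mtr T) none, theSST_layered k (mtr T) none, ?_⟩
  intro w
  rw [theSST_eval]
  unfold exc
  cases hv : vis (gsys (mtr T) (tapeAt w) k) (w.length + 2) none with
  | some p =>
    obtain ⟨e, L⟩ := p
    have hp := run_eq_some.1 hv
    obtain ⟨L1, h1⟩ := none_walk' T w k _ le_rfl _ _ hp
    obtain ⟨L2, h2, h3⟩ := none_walk T w k h1 _ le_rfl
    obtain ⟨rfl, -⟩ := hp.uniq h2
    obtain ⟨qf, hqf, hs⟩ := acc_steps T w k h1 T.q0 0 rfl (by omega)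
    simp only [Option.map_some]
    rw [h3]
    exact ((hf w _).2 ⟨qf, hqf, hs⟩).symm
  | none =>
    simp only [Option.map_none]
    cases hw : f w with
    | none => rfl
    | some v =>
      obtain ⟨qf, hqf, hs⟩ := (hf w v).1 hw
      have hd := DD_of_steps T w k hs hqf rfl (Nat.zero_le _) (fun u c' h => hT w u c' h)
      obtain ⟨L, e, hp⟩ := hd
      obtain ⟨L2, h2, h3⟩ := none_walk T w k hp _ le_rfl
      have := run_eq_some.2 h2
      exact absurd (hv.symm.trans this) (by simp)

end MS

namespace MS

open Classical

/-! ### Bounded deterministic runs of marble transducers -/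

abbrev Cfg {A B : Type} (T : MarbleT A B) := T.Q × ℕ × List (T.C × ℕ)

/-- One step. -/
noncomputable def cstep {A B : Type} (T : MarbleT A B) (w : List A) (c : Cfg T) :
    Option (Cfg T × List B) :=
  match T.trans c.1 (tapeAt w c.2.1) (marbleAt c.2.1 c.2.2) with
  | none => none
  | some ((q', MAct.left), v) => if 1 ≤ c.2.1 then some ((q', c.2.1 - 1, c.2.2), v) else none
  | some ((q', MAct.right), v) =>
    if marbleAt c.2.1 c.2.2 = none ∧ c.2.1 ≤ w.length then some ((q', c.2.1 + 1, c.2.2), v)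
    else none
  | some ((q', MAct.lift), v) =>
    if marbleAt c.2.1 c.2.2 = none then none else some ((q', c.2.1, c.2.2.tail), v)
  | some ((q', MAct.drop cc), v) =>
    if marbleAt c.2.1 c.2.2 = none then some ((q', c.2.1, (cc, c.2.1) :: c.2.2), v) else none

inductive BR {A B : Type} (T : MarbleT A B) (w : List A) (k : ℕ) :
    Cfg T → List B → Cfg T → Prop
  | nil {c : Cfg T} : c.2.2.length ≤ k → BR T w k c [] c
  | cons {c c' e : Cfg T} {v u : List B} : c.2.2.length ≤ k → cstep T w c = some (c', v) →
      BR T w k c' u e → BR T w k c (v ++ u) e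

theorem BR.trans {A B : Type} {T : MarbleT A B} {w : List A} {k : ℕ} {c c' c'' : Cfg T}
    {u v : List B} (h : BR T w k c u c') (h' : BR T w k c' v c'') : BR T w k c (u ++ v) c'' := by
  induction h with
  | nil _ => exact h'
  | cons h1 h2 _ ih => rw [List.append_assoc]; exact .cons h1 h2 (ih h')

theorem BR.len {A B : Type} {T : MarbleT A B} {w : List A} {k : ℕ} {c c' : Cfg T}
    {u : List B} (h : BR T w k c u c') : c.2.2.length ≤ k := by
  cases h <;> assumption

theorem steps_of_cstep {A B : Type} {T : MarbleT A B} {w : List A} {c c' e : Cfg T}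
    {u v : List B} (h : cstep T w c = some (c', v)) (h' : MarbleT.Steps T w c' u e) :
    MarbleT.Steps T w c (v ++ u) e := by
  obtain ⟨q, m, π⟩ := c
  unfold cstep at h
  simp only at h
  rcases ht : T.trans q (tapeAt w m) (marbleAt m π) with _ | ⟨⟨q', act⟩, v'⟩
  · simp [ht] at h
  · cases act with
    | left =>
      simp [ht] at h
      obtain ⟨h1, rfl, rfl⟩ := h
      exact .stepL ht h1 h'
    | right =>
      simp [ht] at h
      obtain ⟨⟨h0, h1⟩, rfl, rfl⟩ := h
      rw [h0] at ht
      exact .stepR h0 ht h1 h'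
    | drop cc =>
      simp [ht] at h
      obtain ⟨h0, rfl, rfl⟩ := h
      rw [h0] at ht
      exact .stepDrop h0 ht h'
    | lift =>
      simp [ht] at h
      obtain ⟨h0, rfl, rfl⟩ := h
      cases π with
      | nil => simp [marbleAt] at h0
      | cons x π =>
        obtain ⟨cc, p⟩ := x
        simp [marbleAt] at h0
        subst h0
        simp [marbleAt] at ht
        exact .stepLift ht h'

theorem BR.steps {A B : Type} {T : MarbleT A B} {w : List A} {k : ℕ} {c c' : Cfg T}
    {u : List B} (h : BR T w k c u c') : MarbleT.Steps T w c u c' := by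
  induction h with
  | nil _ => exact .refl _
  | cons h1 h2 _ ih => exact steps_of_cstep h2 ih

theorem BR.cons_inv {A B : Type} {T : MarbleT A B} {w : List A} {k : ℕ} {c c' e : Cfg T}
    {u v : List B} (h : BR T w k c u e) (he : cstep T w e = none)
    (hc : cstep T w c = some (c', v)) : ∃ u', u = v ++ u' ∧ BR T w k c' u' e := by
  cases h with
  | nil _ => rw [he] at hc; cases hc
  | cons h1 h2 h3 =>
    rw [hc] at h2
    cases h2
    exact ⟨_, rfl, h3⟩

theorem BR.pref {A B : Type} {T : MarbleT A B} {w : List A} {k : ℕ} {c c' e : Cfg T}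
    {u' : List B} (he : cstep T w e = none)
    (h' : MarbleT.Steps T w c u' c') : ∀ {u}, BR T w k c u e →
    ∃ v, u = u' ++ v ∧ BR T w k c' v e := by
  induction h' with
  | refl => intro u h; exact ⟨u, rfl, h⟩
  | @stepL q m π q' v u cf h1 h2 h3 ih =>
    intro u0 h
    obtain ⟨u1, rfl, h5⟩ := h.cons_inv he (c' := (q', m - 1, π)) (v := v) (by simp [cstep, h1, h2])
    obtain ⟨v2, rfl, h6⟩ := ih h5
    exact ⟨v2, by simp, h6⟩
  | @stepR q m π q' v u cf h0 h1 h2 h3 ih =>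
    intro u0 h
    obtain ⟨u1, rfl, h5⟩ := h.cons_inv he (c' := (q', m + 1, π)) (v := v)
      (by simp [cstep, h0, h1, h2])
    obtain ⟨v2, rfl, h6⟩ := ih h5
    exact ⟨v2, by simp, h6⟩
  | @stepLift q m π q' cc v u cf h1 h3 ih =>
    intro u0 h
    obtain ⟨u1, rfl, h5⟩ := h.cons_inv he (c' := (q', m, π)) (v := v)
      (by simp [cstep, marbleAt, h1])
    obtain ⟨v2, rfl, h6⟩ := ih h5
    exact ⟨v2, by simp, h6⟩
  | @stepDrop q m π q' cc v u cf h0 h1 h3 ih =>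
    intro u0 h
    obtain ⟨u1, rfl, h5⟩ := h.cons_inv he (c' := (q', m, (cc, m) :: π)) (v := v)
      (by simp [cstep, h0, h1])
    obtain ⟨v2, rfl, h6⟩ := ih h5
    exact ⟨v2, by simp, h6⟩

/-! ### The machine -/

/-- Split a word at its first register. -/
def sp {B X : Type} : List (B ⊕ X) → List B × Option (X × List (B ⊕ X))
  | [] => ([], none)
  | Sum.inl b :: l => (b :: (sp l).1, (sp l).2)
  | Sum.inr x :: l => ([], some (x, l))

theorem sp_none {B X : Type} (v : X → List B) (l : List (B ⊕ X)) (h : (sp l).2 = none) :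
    evalSubst v l = (sp l).1 := by
  induction l with
  | nil => rfl
  | cons a l ih =>
    cases a with
    | inl b => simp [sp] at h ⊢; rw [← ih h]; rfl
    | inr x => simp [sp] at h

theorem sp_some {B X : Type} (v : X → List B) (l l' : List (B ⊕ X)) (y : X)
    (h : (sp l).2 = some (y, l')) :
    evalSubst v l = (sp l).1 ++ (v y ++ evalSubst v l') ∧ ∃ p, l = p ++ Sum.inr y :: l' := by
  induction l with
  | nil => simp [sp] at h
  | cons a l ih =>
    cases a with
    | inl b =>
      simp [sp] at h
      obtain ⟨h1, p, h2⟩ := ih h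
      refine ⟨?_, Sum.inl b :: p, by rw [h2]; rfl⟩
      simp only [sp, List.cons_append]
      rw [← h1]; rfl
    | inr x =>
      simp [sp] at h
      obtain ⟨rfl, rfl⟩ := h
      exact ⟨rfl, [], rfl⟩

section machine
variable {A B : Type} (S : SST A B)

/-- All suffixes of words occurring in the transducer. -/
def WS : Set (List (B ⊕ S.X)) :=
  {l | l = [] ∨ (∃ q a p x, S.trans q a = some p ∧ l <:+ p.2 x) ∨ ∃ q o, S.out q = some o ∧ l <:+ o}

theorem WS_finite [Fintype A] : (WS S).Finite := by
  have h1 : (⋃ i : S.Q × A × S.X, {l | ∃ p, S.trans i.1 i.2.1 = some p ∧ l <:+ p.2 i.2.2}).Finite := by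
    refine Set.finite_iUnion ?_
    rintro ⟨q, a, x⟩
    cases h : S.trans q a with
    | none => simp [h]
    | some p =>
      refine (List.finite_toSet (p.2 x).tails).subset ?_
      rintro l ⟨p', hp', hl⟩
      simp only [h, Option.some.injEq] at hp'
      subst hp'
      exact (List.mem_tails _ _).2 hl
  have h2 : (⋃ q : S.Q, {l | ∃ o, S.out q = some o ∧ l <:+ o}).Finite := by
    refine Set.finite_iUnion ?_
    intro q
    cases h : S.out q with
    | none => simp
    | some o =>
      refine (List.finite_toSet o.tails).subset ?_
      rintro l ⟨p', hp', hl⟩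
      simp only [Option.some.injEq] at hp'
      subst hp'
      exact (List.mem_tails _ _).2 hl
  refine ((Set.finite_singleton []).union (h1.union h2)).subset ?_
  rintro l (h | ⟨q, a, p, x, h, hl⟩ | ⟨q, o, h, hl⟩)
  · exact Or.inl h
  · exact Or.inr (Or.inl (Set.mem_iUnion.2 ⟨(q, a, x), p, h, hl⟩))
  · exact Or.inr (Or.inr (Set.mem_iUnion.2 ⟨q, o, h, hl⟩))

abbrev Wd := {l : List (B ⊕ S.X) // l ∈ WS S}

noncomputable def mkW (l : List (B ⊕ S.X)) : Wd S := if h : l ∈ WS S then ⟨l, h⟩ else ⟨[], Or.inl rfl⟩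

theorem mkW_val {l : List (B ⊕ S.X)} (h : l ∈ WS S) : (mkW S l).1 = l := by
  simp [mkW, h]

end machine

inductive Md (X W : Type) where
  | fwd
  | start (x : X) (i : W)
  | ret (x : X) (i : W)
  | proc (x : X) (l : W) (i : W)
  | enter (x : X) (i : W)

inductive Sta (P X W : Type) where
  | pt (s : P) (md : Md X W)
  | dn1 (s : P) (y : X) (i : W)
  | dn (g : P → Option P) (y : X) (i : W)
  | r2 (t1 t2 : P) (y : X) (i : W)
  | fin1
  | fin

instance Md_finite (X W : Type) [Finite X] [Finite W] : Finite (Md X W) := by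
  let e : Md X W → (Unit ⊕ (X × W)) ⊕ ((X × W) ⊕ ((X × W × W) ⊕ (X × W))) := fun m =>
    match m with
    | .fwd => .inl (.inl ())
    | .start x i => .inl (.inr (x, i))
    | .ret x i => .inr (.inl (x, i))
    | .proc x l i => .inr (.inr (.inl (x, l, i)))
    | .enter x i => .inr (.inr (.inr (x, i)))
  refine Finite.of_injective e ?_
  intro a b h
  cases a <;> cases b <;> simp [e] at h <;> simp [h]

instance Sta_finite (P X W : Type) [Finite P] [Finite X] [Finite W] : Finite (Sta P X W) := by
  let e : Sta P X W → (Unit ⊕ Unit) ⊕ ((P × Md X W) ⊕ ((P × X × W) ⊕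
      (((P → Option P) × X × W) ⊕ (P × P × X × W)))) := fun m =>
    match m with
    | .fin1 => .inl (.inl ())
    | .fin => .inl (.inr ())
    | .pt s m => .inr (.inl (s, m))
    | .dn1 s y i => .inr (.inr (.inl (s, y, i)))
    | .dn g y i => .inr (.inr (.inr (.inl (g, y, i))))
    | .r2 s t y i => .inr (.inr (.inr (.inr (s, t, y, i))))
  refine Finite.of_injective e ?_
  intro a b h
  cases a <;> cases b <;> simp [e] at h <;> simp [h]

/-- The unique value of a partial function, if any. -/
noncomputable def uniq {P : Type} (g : P → Option P) : Option P :=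
  if h : ∃ c, (∃ s, g s = some c) ∧ ∀ s c', g s = some c' → c' = c then some h.choose else none

theorem uniq_some {P : Type} {g : P → Option P} {c s c' : P} (h : uniq g = some c)
    (hs : g s = some c') : c' = c := by
  unfold uniq at h
  split_ifs at h with h1
  cases h
  exact h1.choose_spec.2 s c' hs

theorem uniq_none {P : Type} {g : P → Option P} {c s : P} (h : uniq g = none)
    (hs : g s = some c) : ∃ t c', g t = some c' ∧ c' ≠ c := by
  by_contra hc
  push Not at hc
  have : ∃ c, (∃ s, g s = some c) ∧ ∀ s c', g s = some c' → c' = c := ⟨c, ⟨s, hs⟩, hc⟩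
  simp only [uniq, dif_pos this] at h
  cases h

section machine2
variable {A B : Type} (S : SST A B) {k : ℕ} (layer : S.X → Fin (k + 1))

abbrev PS := Option S.Q
abbrev MSt := Sta (PS S) S.X (Wd S)
abbrev MC := S.X × Wd S
abbrev MR := Option ((MSt S × MAct (MC S)) × List B)

/-- State tracking. -/
def DT : PS S → TapeSym A → Option (PS S)
  | none, TapeSym.lend => some (some S.q0)
  | some q, TapeSym.letter a => (S.trans q a).map (fun p => some p.1)
  | _, _ => none

noncomputable def procAct (s s' : PS S) (x : S.X) (l : List (B ⊕ S.X)) (i : Wd S) : MR S :=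
  match sp l with
  | (u, none) => some ((.pt s' (.ret x i), MAct.right), u)
  | (u, some (y, l')) =>
    if layer y = layer x then some ((.dn1 s y i, MAct.left), u)
    else some ((.pt s (.enter y i), MAct.drop (x, mkW S l')), u)

noncomputable def topAct (s : PS S) (l : List (B ⊕ S.X)) : MR S :=
  match sp l with
  | (u, none) => some ((.fin1, MAct.left), u)
  | (u, some (y, l')) => some ((.dn1 s y (mkW S l'), MAct.left), u)

def Fits (σ : S.X → List (B ⊕ S.X)) (x : S.X) (p : S.X × List (B ⊕ S.X)) : Prop :=
  layer p.1 = layer x ∧ ∃ pr, σ p.1 = pr ++ Sum.inr x :: p.2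

noncomputable def act (s : PS S) : Md S.X (Wd S) → TapeSym A → Option (MC S) → MR S
  | .fwd, TapeSym.rend, none =>
    match s with
    | some q => (match S.out q with | some o => topAct S s o | none => none)
    | none => none
  | .fwd, a, none => (DT S s a).map (fun s' => ((.pt s' .fwd, MAct.right), []))
  | .start x i, TapeSym.lend, none => some ((.pt (some S.q0) (.ret x i), MAct.right), S.init x)
  | .start x i, TapeSym.letter a, none =>
    match s with
    | none => none
    | some q => (S.trans q a).bind (fun p => procAct S layer s (some p.1) x (p.2 x) i)
  | .ret _ i, TapeSym.rend, none => topAct S s i.1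
  | .ret x i, TapeSym.letter a, none =>
    match s with
    | none => none
    | some q => (S.trans q a).bind (fun p =>
        if h : ∃ z, Fits S layer p.2 x z then procAct S layer s (some p.1) h.choose.1 h.choose.2 i
        else none)
  | .proc x l i, TapeSym.letter a, none =>
    match s with
    | none => none
    | some q => (S.trans q a).bind (fun p => procAct S layer s (some p.1) x l.1 i)
  | .enter y i, _, some _ => some ((.dn1 s y i, MAct.left), [])
  | .ret _ i, _, some c => some ((.pt s (.proc c.1 c.2 i), MAct.lift), [])
  | _, _, _ => none

theorem act_marked (s : PS S) (md : Md S.X (Wd S)) (a : TapeSym A) (c : MC S)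
    (p : (MSt S × MAct (MC S)) × List B) (h : act S layer s md a (some c) = some p) :
    p.1.2 = MAct.left ∨ p.1.2 = MAct.lift := by
  cases md <;> cases a <;> simp [act] at h <;> subst h <;> simp

noncomputable def g0 (t : PS S) (a : TapeSym A) (s : PS S) : Option (PS S) :=
  if DT S s a = some t then some s else none

def gst (g : PS S → Option (PS S)) (a : TapeSym A) (s : PS S) : Option (PS S) :=
  (DT S s a).bind g

noncomputable def mact : MSt S → TapeSym A → Option (MC S) → MR S
  | .pt s md, a, c => act S layer s md a c
  | .dn1 t y i, a, none =>
    match uniq (g0 S t a) with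
    | some c => act S layer c (.start y i) a none
    | none => some ((.dn (g0 S t a) y i, MAct.left), [])
  | .dn g y i, a, none =>
    match uniq (gst S g a) with
    | some c =>
      if h : ∃ t : PS S × PS S, g t.1 = some c ∧ ∃ c', c' ≠ c ∧ g t.2 = some c' then
        some ((.r2 h.choose.1 h.choose.2 y i, MAct.right), []) else none
    | none => some ((.dn (gst S g a) y i, MAct.left), [])
  | .r2 t1 t2 y i, a, none =>
    match DT S t1 a, DT S t2 a with
    | some u1, some u2 => if u1 = u2 then act S layer t1 (.start y i) a none
      else some ((.r2 u1 u2 y i, MAct.right), [])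
    | _, _ => none
  | .fin1, _, none => some ((.fin, MAct.right), [])
  | _, _, _ => none

theorem mact_marked (st : MSt S) (a : TapeSym A) (c : MC S)
    (p : (MSt S × MAct (MC S)) × List B) (h : mact S layer st a (some c) = some p) :
    p.1.2 = MAct.left ∨ p.1.2 = MAct.lift := by
  cases st with
  | pt s md => exact act_marked S layer s md a c p h
  | _ => simp [mact] at h

noncomputable def theM [Fintype A] : MarbleT A B where
  Q := MSt S
  C := MC S
  finQ := by
    have := (WS_finite S).to_subtype
    exact Fintype.ofFinite _
  finC := by
    have := (WS_finite S).to_subtype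
    exact Fintype.ofFinite _
  q0 := .pt none .fwd
  final := {.fin}
  trans := mact S layer
  marble_left_or_lift := fun q s c p h => mact_marked S layer q s c p h

end machine2

end MS

namespace MS

open Classical

section gen
variable {A B : Type} {T : MarbleT A B} {w : List A} {k : ℕ}

theorem BR.left {st st' : T.Q} {m : ℕ} {π : List (T.C × ℕ)} {v u : List B} {e : Cfg T}
    (h : T.trans st (tapeAt w (m + 1)) (marbleAt (m + 1) π) = some ((st', MAct.left), v))
    (h' : BR T w k (st', m, π) u e) : BR T w k (st, m + 1, π) (v ++ u) e := by
  refine BR.cons (c := (st, m + 1, π)) (c' := (st', m, π)) h'.len ?_ h'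
  simp [cstep, h]

theorem BR.right {st st' : T.Q} {m : ℕ} {π : List (T.C × ℕ)} {v u : List B} {e : Cfg T}
    (h0 : marbleAt m π = none) (hm : m ≤ w.length)
    (h : T.trans st (tapeAt w m) none = some ((st', MAct.right), v))
    (h' : BR T w k (st', m + 1, π) u e) : BR T w k (st, m, π) (v ++ u) e := by
  refine BR.cons (c := (st, m, π)) (c' := (st', m + 1, π)) h'.len ?_ h'
  simp [cstep, h0, h, hm]

theorem BR.drop {st st' : T.Q} {m : ℕ} {π : List (T.C × ℕ)} {v u : List B} {e : Cfg T}
    {cc : T.C} (h0 : marbleAt m π = none)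
    (h : T.trans st (tapeAt w m) none = some ((st', MAct.drop cc), v))
    (h' : BR T w k (st', m, (cc, m) :: π) u e) : BR T w k (st, m, π) (v ++ u) e := by
  refine BR.cons (c := (st, m, π)) (c' := (st', m, (cc, m) :: π)) ?_ ?_ h'
  · have := h'.len
    simp at this ⊢
    omega
  simp [cstep, h0, h]

theorem BR.lift {st st' : T.Q} {m : ℕ} {π : List (T.C × ℕ)} {v u : List B} {e : Cfg T}
    {cc : T.C} (hk : π.length + 1 ≤ k)
    (h : T.trans st (tapeAt w m) (some cc) = some ((st', MAct.lift), v))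
    (h' : BR T w k (st', m, π) u e) : BR T w k (st, m, (cc, m) :: π) (v ++ u) e := by
  refine BR.cons (c := (st, m, (cc, m) :: π)) (c' := (st', m, π)) ?_ ?_ h'
  · simpa using hk
  simp [cstep, marbleAt, h]

end gen

section correct
variable {A B : Type} [Fintype A] (S : SST A B) {k : ℕ} (layer : S.X → Fin (k + 1)) (w : List A)

abbrev KC := MSt S × ℕ × List (MC S × ℕ)

/-- Bounded runs of the machine. -/
def RR (c : KC S) (u : List B) (e : KC S) : Prop :=
  BR (theM S layer) w k c u e

variable {S layer w}

theorem RR.refl {c : KC S} (h : c.2.2.length ≤ k) : RR S layer w c [] c := BR.nil h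

theorem RR.trans {c c' e : KC S} {u v : List B} (h : RR S layer w c u c')
    (h' : RR S layer w c' v e) : RR S layer w c (u ++ v) e := BR.trans h h'

theorem RR.len {c e : KC S} {u : List B} (h : RR S layer w c u e) : c.2.2.length ≤ k := BR.len h

theorem RR.left {st st' : MSt S} {m : ℕ} {π : List (MC S × ℕ)} {v u : List B} {e : KC S}
    (h : mact S layer st (tapeAt w (m + 1)) (marbleAt (m + 1) π) = some ((st', MAct.left), v))
    (h' : RR S layer w (st', m, π) u e) : RR S layer w (st, m + 1, π) (v ++ u) e :=
  BR.left (T := theM S layer) h h'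

theorem RR.right {st st' : MSt S} {m : ℕ} {π : List (MC S × ℕ)} {v u : List B} {e : KC S}
    (h0 : marbleAt m π = none) (hm : m ≤ w.length)
    (h : mact S layer st (tapeAt w m) none = some ((st', MAct.right), v))
    (h' : RR S layer w (st', m + 1, π) u e) : RR S layer w (st, m, π) (v ++ u) e :=
  BR.right (T := theM S layer) h0 hm h h'

theorem RR.drop {st st' : MSt S} {m : ℕ} {π : List (MC S × ℕ)} {v u : List B} {e : KC S}
    {cc : MC S} (h0 : marbleAt m π = none)
    (h : mact S layer st (tapeAt w m) none = some ((st', MAct.drop cc), v))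
    (h' : RR S layer w (st', m, (cc, m) :: π) u e) : RR S layer w (st, m, π) (v ++ u) e :=
  BR.drop (T := theM S layer) h0 h h'

theorem RR.lift {st st' : MSt S} {m : ℕ} {π : List (MC S × ℕ)} {v u : List B} {e : KC S}
    {cc : MC S} (hk : π.length + 1 ≤ k)
    (h : mact S layer st (tapeAt w m) (some cc) = some ((st', MAct.lift), v))
    (h' : RR S layer w (st', m, π) u e) : RR S layer w (st, m, (cc, m) :: π) (v ++ u) e :=
  BR.lift (T := theM S layer) hk h h'


theorem run_decomp (w : List A) : ∀ (q : S.Q) (v : S.X → List B),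
    ∃ (M : ℕ) (qs : ℕ → S.Q) (vs : ℕ → S.X → List B), M ≤ w.length ∧ qs 0 = q ∧ vs 0 = v ∧
      (∀ m, m < M → ∃ (a : A) (σ : S.X → List (B ⊕ S.X)), w[m]? = some a ∧
        S.trans (qs m) a = some (qs (m + 1), σ) ∧
        vs (m + 1) = fun x => evalSubst (vs m) (σ x)) ∧
      ((M = w.length ∧ S.runFrom q v w = some (qs M, vs M)) ∨
        (S.runFrom q v w = none ∧ ∃ a, w[M]? = some a ∧ S.trans (qs M) a = none)) := by
  induction w with
  | nil =>
    intro q v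
    exact ⟨0, fun _ => q, fun _ => v, le_rfl, rfl, rfl, by simp, Or.inl ⟨rfl, rfl⟩⟩
  | cons a w ih =>
    intro q v
    rcases ht : S.trans q a with _ | ⟨q', σ⟩
    · exact ⟨0, fun _ => q, fun _ => v, Nat.zero_le _, rfl, rfl, by simp,
        Or.inr ⟨by simp [SST.runFrom, ht], a, rfl, ht⟩⟩
    · obtain ⟨M, qs, vs, hM, h1, h2, h3, h4⟩ := ih q' (fun x => evalSubst v (σ x))
      refine ⟨M + 1, fun m => Nat.casesOn m q qs, fun m => Nat.casesOn m v vs, by simpa using hM,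
        rfl, rfl, ?_, ?_⟩
      · intro m hm
        cases m with
        | zero => exact ⟨a, σ, rfl, by simpa [h1] using ht, h2⟩
        | succ m =>
          obtain ⟨b, τ, hb, hτ, hv⟩ := h3 m (by omega)
          exact ⟨b, τ, by simpa using hb, hτ, hv⟩
      · rcases h4 with ⟨h5, h6⟩ | ⟨h5, b, h6, h7⟩
        · exact Or.inl ⟨by simp [h5], by simpa [SST.runFrom, ht] using h6⟩
        · exact Or.inr ⟨by simpa [SST.runFrom, ht] using h5, b, by simpa using h6, h7⟩

/-! #### Uniqueness -/

theorem occ_pos {B X : Type} (x : X) (p l : List (B ⊕ X)) :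
    occCount x (p ++ Sum.inr x :: l) = occCount x p + occCount x l + 1 := by
  unfold occCount
  rw [List.countP_append, List.countP_cons_of_pos (by simp)]
  omega

theorem occ_zero {B X : Type} (x : X) (p : List (B ⊕ X)) (h : occCount x p = 0) :
    Sum.inr x ∉ p := by
  intro hx
  unfold occCount at h
  rw [List.countP_eq_zero] at h
  exact h _ hx (by simp)

theorem split_unique {B X : Type} (x : X) : ∀ (p1 p2 l1 l2 : List (B ⊕ X)), Sum.inr x ∉ p1 →
    Sum.inr x ∉ p2 → p1 ++ Sum.inr x :: l1 = p2 ++ Sum.inr x :: l2 → l1 = l2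
  | [], [], l1, l2, _, _, h => by simpa using h
  | [], a :: p2, l1, l2, _, h2, h => by
    simp at h; exact absurd (by rw [h.1]; simp) h2
  | a :: p1, [], l1, l2, h1, _, h => by
    simp at h; exact absurd (by rw [h.1]; simp) h1
  | a :: p1, b :: p2, l1, l2, h1, h2, h => by
    simp at h h1 h2
    exact split_unique x p1 p2 l1 l2 h1.2 h2.2 h.2

theorem fits_unique {σ : S.X → List (B ⊕ S.X)} {x : S.X}
    (h : (∑ y ∈ Finset.univ.filter (fun y => layer y = layer x), occCount x (σ y)) ≤ 1)
    {z1 z2 : S.X × List (B ⊕ S.X)} (h1 : Fits S layer σ x z1) (h2 : Fits S layer σ x z2) :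
    z1 = z2 := by
  obtain ⟨y1, l1⟩ := z1
  obtain ⟨y2, l2⟩ := z2
  obtain ⟨hl1, p1, e1⟩ := h1
  obtain ⟨hl2, p2, e2⟩ := h2
  simp only at hl1 hl2 e1 e2
  have hy : y1 = y2 := by
    by_contra hne
    have hsub : ({y1, y2} : Finset S.X) ⊆ Finset.univ.filter (fun y => layer y = layer x) := by
      intro y hy
      simp at hy
      rcases hy with rfl | rfl <;> simp [hl1, hl2]
    have h3 := Finset.sum_le_sum_of_subset (f := fun y => occCount x (σ y)) hsub
    rw [Finset.sum_pair hne, e1, e2, occ_pos, occ_pos] at h3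
    omega
  subst hy
  have h3 : occCount x (σ y1) ≤ 1 := le_trans
    (Finset.single_le_sum (f := fun y => occCount x (σ y)) (fun _ _ => Nat.zero_le _)
      (by simp [hl1])) h
  have h4 := h3
  rw [e1, occ_pos] at h3
  rw [e2, occ_pos] at h4
  have := split_unique x p1 p2 l1 l2 (occ_zero _ _ (by omega)) (occ_zero _ _ (by omega))
    (e1.symm.trans e2)
  rw [this]

/-! #### Going one step back -/

variable (S w) in
noncomputable def GF (t : PS S) : ℕ → ℕ → PS S → Option (PS S)
  | 0, j => g0 S t (tapeAt w j)
  | d + 1, j => gst S (GF t d (j + 1)) (tapeAt w j)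

theorem hu_return {t : PS S} {m : ℕ} (hm : m ≤ w.length) {sm : PS S}
    {y : S.X} {i : Wd S} {π : List (MC S × ℕ)}
    (hπ : ∀ j ≤ m, marbleAt j π = none) (hk : π.length ≤ k) :
    ∀ (d p : ℕ) (t1 t2 c' : PS S), p + d = m → GF S w t d p t1 = some sm →
      GF S w t d p t2 = some c' → c' ≠ sm →
      ∃ st', mact S layer st' (tapeAt w m) none = act S layer sm (.start y i) (tapeAt w m) none ∧
        RR S layer w (.r2 t1 t2 y i, p, π) [] (st', m, π) := by
  intro d
  induction d with
  | zero =>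
    intro p t1 t2 c' hp h1 h2 hne
    obtain rfl : p = m := by omega
    simp only [GF, g0] at h1 h2
    split_ifs at h1 with h1'
    split_ifs at h2 with h2'
    cases h1
    cases h2
    exact ⟨_, by simp [mact, h1', h2'], RR.refl hk⟩
  | succ d ih =>
    intro p t1 t2 c' hp h1 h2 hne
    simp only [GF, gst, Option.bind_eq_some_iff] at h1 h2
    obtain ⟨u1, hu1, h1⟩ := h1
    obtain ⟨u2, hu2, h2⟩ := h2
    have hu : u1 ≠ u2 := by
      rintro rfl
      rw [h1] at h2
      cases h2
      exact hne rfl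
    obtain ⟨st', hs, hr⟩ := ih (p + 1) u1 u2 c' (by omega) h1 h2 hne
    refine ⟨st', hs, ?_⟩
    exact RR.right (v := []) (hπ p (by omega)) (by omega) (by simp [mact, hu1, hu2, hu]) hr

variable (S) in
theorem DT_zero (s s' : PS S) (h : DT S s (tapeAt w 0) = some s') : s = none := by
  rw [tapeAt_zero] at h
  cases s with
  | none => rfl
  | some q => simp [DT] at h

theorem hu_down {t : PS S} {m : ℕ} (hm : m ≤ w.length) {ss : ℕ → PS S}
    (hss : ∀ j < m, DT S (ss j) (tapeAt w j) = some (ss (j + 1)))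
    (ht : DT S (ss m) (tapeAt w m) = some t)
    {y : S.X} {i : Wd S} {π : List (MC S × ℕ)}
    (hπ : ∀ j ≤ m, marbleAt j π = none) (hk : π.length ≤ k) :
    ∀ (j d : ℕ), j + 1 + d = m → uniq (GF S w t d (j + 1)) = none →
      ∃ st', mact S layer st' (tapeAt w m) none
          = act S layer (ss m) (.start y i) (tapeAt w m) none ∧
        RR S layer w (.dn (GF S w t d (j + 1)) y i, j, π) [] (st', m, π) := by
  have hGF : ∀ d p, p + d = m → GF S w t d p (ss p) = some (ss m) := by
    intro d
    induction d with
    | zero =>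
      intro p hp
      obtain rfl : p = m := by omega
      simp [GF, g0, ht]
    | succ d ih =>
      intro p hp
      simp [GF, gst, hss p (by omega), ih (p + 1) (by omega)]
  have base : ∀ j d, j + 1 + d = m → uniq (GF S w t d (j + 1)) = none →
      uniq (GF S w t (d + 1) j) ≠ none →
      ∃ st', mact S layer st' (tapeAt w m) none
          = act S layer (ss m) (.start y i) (tapeAt w m) none ∧
        RR S layer w (.dn (GF S w t d (j + 1)) y i, j, π) [] (st', m, π) := by
    intro j d hd hu hne
    obtain ⟨c, hc⟩ := Option.ne_none_iff_exists'.1 hne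
    obtain rfl := uniq_some hc (hGF (d + 1) j (by omega))
    have hg := hGF d (j + 1) (by omega)
    have hex : ∃ t' : PS S × PS S, GF S w t d (j + 1) t'.1 = some (ss m) ∧
        ∃ c', c' ≠ ss m ∧ GF S w t d (j + 1) t'.2 = some c' := by
      obtain ⟨t', c', h1, h2⟩ := uniq_none hu hg
      exact ⟨(ss (j + 1), t'), hg, c', h2, h1⟩
    obtain ⟨h1, c', h2, h3⟩ := hex.choose_spec
    obtain ⟨st', h4, h5⟩ := hu_return (layer := layer) (y := y) (i := i) hm hπ hk d (j + 1) _ _ c'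
      hd h1 h3 h2
    refine ⟨st', h4, RR.right (v := []) (hπ _ (by omega)) (by omega) ?_ h5⟩
    simp only [GF] at hc
    simp only [mact, hc]
    rw [dif_pos hex]
  intro j
  induction j with
  | zero =>
    intro d hd hu
    have h1 : GF S w t (d + 1) 0 (ss 0) = some (ss m) := hGF (d + 1) 0 (by omega)
    have hne : uniq (GF S w t (d + 1) 0) ≠ none := by
      intro hn
      obtain ⟨t', c', h2, h3⟩ := uniq_none hn h1
      have e1 : t' = none := by
        simp only [GF, gst, Option.bind_eq_some_iff] at h2
        obtain ⟨u, h2, _⟩ := h2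
        exact DT_zero S _ _ h2
      have e2 : ss 0 = none := DT_zero S _ _ (hss 0 (by omega))
      rw [e1] at h2
      rw [e2, h2] at h1
      cases h1
      exact h3 rfl
    exact base 0 d hd hu hne
  | succ j ih =>
    intro d hd hu
    by_cases hne : uniq (GF S w t (d + 1) (j + 1)) = none
    · obtain ⟨st', h1, h2⟩ := ih (d + 1) (by omega) hne
      refine ⟨st', h1, RR.left (v := []) ?_ h2⟩
      rw [hπ _ (by omega)]
      simp only [GF] at hne ⊢
      simp only [mact, hne]
    · exact base (j + 1) d hd hu hne

theorem hu_all {m : ℕ} (hm : m ≤ w.length) {ss : ℕ → PS S}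
    (hss : ∀ j ≤ m, DT S (ss j) (tapeAt w j) = some (ss (j + 1)))
    (y : S.X) (i : Wd S) {π : List (MC S × ℕ)}
    (hπ : ∀ j ≤ m, marbleAt j π = none) (hk : π.length ≤ k) :
    ∃ st', mact S layer st' (tapeAt w m) none
          = act S layer (ss m) (.start y i) (tapeAt w m) none ∧
        RR S layer w (.dn1 (ss (m + 1)) y i, m, π) [] (st', m, π) := by
  have h0 : g0 S (ss (m + 1)) (tapeAt w m) (ss m) = some (ss m) := by
    simp [g0, hss m le_rfl]
  rcases hu : uniq (g0 S (ss (m + 1)) (tapeAt w m)) with _ | c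
  · cases m with
    | zero =>
      exfalso
      obtain ⟨t', c', h2, h3⟩ := uniq_none hu h0
      simp only [g0] at h2
      split_ifs at h2 with h2'
      cases h2
      exact h3 ((DT_zero S _ _ h2').trans (DT_zero S _ _ (hss 0 le_rfl)).symm)
    | succ m =>
      obtain ⟨st', h1, h2⟩ := hu_down (t := ss (m + 1 + 1)) (layer := layer) hm
        (fun j hj => hss j hj.le)
        (hss _ le_rfl) (y := y) (i := i) hπ hk m 0 rfl hu
      refine ⟨st', h1, RR.left (v := []) ?_ h2⟩
      rw [hπ _ (by omega)]
      simp only [mact, hu, GF]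
  · obtain rfl := uniq_some hu h0
    exact ⟨_, by simp only [mact, hu], RR.refl hk⟩

end correct

end MS

namespace MS

open Classical

section prod
variable {A B : Type} [Fintype A] {S : SST A B} {k : ℕ} {layer : S.X → Fin (k + 1)} {w : List A}

/-- The sequence of tracked states. -/
def sseq (qs : ℕ → S.Q) : ℕ → PS S
  | 0 => none
  | m + 1 => some (qs m)

/-- A run of length `M`. -/
structure IsRun (S : SST A B) (w : List A) (M : ℕ) (qs : ℕ → S.Q) (vs : ℕ → S.X → List B) :
    Prop where
  le : M ≤ w.length
  q0 : qs 0 = S.q0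
  v0 : vs 0 = S.init
  step : ∀ m, m < M → ∃ (a : A) (σ : S.X → List (B ⊕ S.X)), w[m]? = some a ∧
        S.trans (qs m) a = some (qs (m + 1), σ) ∧
        vs (m + 1) = fun x => evalSubst (vs m) (σ x)

theorem tapeAt_of {m : ℕ} {a : A} (h : w[m]? = some a) : tapeAt w (m + 1) = .letter a := by
  simp [tapeAt, h]

theorem IsRun.hss {M : ℕ} {qs : ℕ → S.Q} {vs : ℕ → S.X → List B} (h : IsRun S w M qs vs)
    {j : ℕ} (hj : j ≤ M) : DT S (sseq qs j) (tapeAt w j) = some (sseq qs (j + 1)) := by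
  cases j with
  | zero => rw [tapeAt_zero]; simp [sseq, DT, h.q0]
  | succ j =>
    obtain ⟨a, σ, h1, h2, _⟩ := h.step j hj
    rw [tapeAt_of h1]
    simp [sseq, DT, h2]

theorem marbleAt_cons {C : Type} {c : C} {m j : ℕ} {π : List (C × ℕ)} (h : j < m) :
    marbleAt j ((c, m) :: π) = none := by
  simp [marbleAt]; omega

theorem production
    (hlay : ∀ q a p, S.trans q a = some p →
      (∀ x y, Sum.inr y ∈ p.2 x → layer y ≤ layer x) ∧
      (∀ y : S.X,
        (∑ x ∈ Finset.univ.filter (fun x => layer x = layer y), occCount y (p.2 x)) ≤ 1))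
    {M : ℕ} {qs : ℕ → S.Q} {vs : ℕ → S.X → List B} (hr : IsRun S w M qs vs) :
    ∀ (m : ℕ), m ≤ M → ∀ (x : S.X) (i : Wd S) (π : List (MC S × ℕ)) (st : MSt S),
      mact S layer st (tapeAt w m) none
        = act S layer (sseq qs m) (.start x i) (tapeAt w m) none →
      (∀ j ≤ m, marbleAt j π = none) → (layer x : ℕ) + π.length ≤ k →
      RR S layer w (st, m, π) (vs m x) (.pt (sseq qs (m + 1)) (.ret x i), m + 1, π) := by
  intro m
  induction m with
  | zero =>
    intro _ x i π st hst hπ hk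
    have h1 : mact S layer st (tapeAt w 0) none
        = some ((.pt (some S.q0) (.ret x i), MAct.right), S.init x) := by
      rw [hst, tapeAt_zero]; simp [act]
    have h2 := RR.right (layer := layer) (hπ 0 le_rfl) (Nat.zero_le _) h1 (RR.refl (by simp; omega))
    simpa [sseq, hr.q0, hr.v0] using h2
  | succ m ih =>
    intro hm
    obtain ⟨a, σ, ha, htr, hv⟩ := hr.step m hm
    obtain ⟨hl1, hl2⟩ := hlay _ _ _ htr
    simp only at hl1 hl2
    have hlen := hr.le
    have htape := tapeAt_of ha
    -- inner lemma
    have inner : ∀ (N : ℕ) (l : List (B ⊕ S.X)), l.length ≤ N →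
        ∀ (x : S.X) (i : Wd S) (π : List (MC S × ℕ)) (st : MSt S), l <:+ σ x →
        mact S layer st (tapeAt w (m + 1)) none
          = procAct S layer (sseq qs (m + 1)) (sseq qs (m + 2)) x l i →
        (∀ j ≤ m + 1, marbleAt j π = none) → (layer x : ℕ) + π.length ≤ k →
        RR S layer w (st, m + 1, π) (evalSubst (vs m) l)
          (.pt (sseq qs (m + 2)) (.ret x i), m + 2, π) := by
      intro N
      induction N with
      | zero =>
        intro l hN x i π st hl hst hπ hk
        obtain rfl : l = [] := by simpa using hN
        have h1 : mact S layer st (tapeAt w (m + 1)) none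
          = some ((.pt (sseq qs (m + 2)) (.ret x i), MAct.right), []) := by
          rw [hst]; simp [procAct, sp]
        exact RR.right (v := []) (hπ _ le_rfl) (by omega) h1 (RR.refl (by simp; omega))
      | succ N ihN =>
        intro l hN x i π st hl hst hπ hk
        rcases hsp : (sp l).2 with _ | ⟨y, l'⟩
        · have h1 : mact S layer st (tapeAt w (m + 1)) none
            = some ((.pt (sseq qs (m + 2)) (.ret x i), MAct.right), (sp l).1) := by
            rw [hst]; simp only [procAct]
            rw [show sp l = ((sp l).1, none) from Prod.ext rfl hsp]
          rw [sp_none _ _ hsp]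
          have := RR.right (hπ _ le_rfl) (by omega) h1 (RR.refl (by simp; omega))
          simpa using this
        · obtain ⟨hev, p, hp⟩ := sp_some (vs m) l l' y hsp
          have hspl : sp l = ((sp l).1, some (y, l')) := Prod.ext rfl hsp
          obtain ⟨p0, hp0⟩ := hl
          have hsx : σ x = (p0 ++ p) ++ Sum.inr y :: l' := by rw [← hp0, hp]; simp
          have hsuf : l' <:+ σ x := ⟨p0 ++ p ++ [Sum.inr y], by rw [hsx]; simp⟩
          have hlen' : l'.length ≤ N := by
            rw [hp] at hN; simp at hN; omega
          have hyx : layer y ≤ layer x := hl1 x y (by rw [hsx]; simp)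
          rw [hev]
          by_cases hyl : layer y = layer x
          · have h1 : mact S layer st (tapeAt w (m + 1)) none
              = some ((.dn1 (sseq qs (m + 1)) y i, MAct.left), (sp l).1) := by
              rw [hst]; simp only [procAct]
              rw [hspl]; simp [hyl]
            obtain ⟨st', hs1, hs2⟩ := hu_all (layer := layer) (w := w) (m := m) (by omega)
              (fun j hj => hr.hss (by omega)) y i (fun j hj => hπ j (by omega)) (by omega)
            have hA := ih (by omega) y i π st' hs1 (fun j hj => hπ j (by omega))
              (by rw [hyl]; exact hk)
            have hB := ihN l' hlen' x i π (.pt (sseq qs (m + 1)) (.ret y i)) hsuf (by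
              have hfit : Fits S layer σ y (x, l') := ⟨hyl.symm, _, hsx⟩
              have hex : ∃ z, Fits S layer σ y z := ⟨_, hfit⟩
              have hch : hex.choose = (x, l') := fits_unique (hl2 y) hex.choose_spec hfit
              rw [htape]
              simp only [mact, sseq, act, htr, Option.bind_some]
              rw [dif_pos hex, hch]) hπ hk
            refine RR.left (by rw [hπ _ le_rfl]; exact h1) ?_
            have := (hs2.trans hA).trans hB
            simpa using this
          · have hlt : (layer y : ℕ) < layer x := by
              exact Fin.lt_def.1 (lt_of_le_of_ne hyx hyl)
            have h1 : mact S layer st (tapeAt w (m + 1)) none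
              = some ((.pt (sseq qs (m + 1)) (.enter y i), MAct.drop (x, mkW S l')),
                (sp l).1) := by
              rw [hst]; simp only [procAct]
              rw [hspl]; simp [hyl]
            have hmk : (mkW S l').1 = l' :=
              mkW_val S (Or.inr (Or.inl ⟨_, _, _, x, htr, hsuf⟩))
            set π' : List (MC S × ℕ) := ((x, mkW S l'), m + 1) :: π with hπ'
            have hk' : (layer y : ℕ) + π'.length ≤ k := by simp [hπ']; omega
            have hπm : ∀ j ≤ m, marbleAt j π' = none :=
              fun j hj => marbleAt_cons (by omega)
            have hat : marbleAt (m + 1) π' = some (x, mkW S l') := by simp [hπ', marbleAt]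
            obtain ⟨st', hs1, hs2⟩ := hu_all (layer := layer) (w := w) (m := m) (by omega)
              (fun j hj => hr.hss (by omega)) y i hπm (by omega)
            have hA := ih (by omega) y i π' st' hs1 hπm hk'
            have hB := ihN l' hlen' x i π (.pt (sseq qs (m + 1)) (.proc x (mkW S l') i)) hsuf (by
              rw [htape]
              simp only [mact, sseq, act, htr, Option.bind_some, hmk]) hπ hk
            have hC : RR S layer w (.pt (sseq qs (m + 1)) (.ret y i), m + 1, π')
                ([] ++ evalSubst (vs m) l') (.pt (sseq qs (m + 2)) (.ret x i), m + 2, π) :=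
              RR.lift (by simp [hπ'] at hk'; omega) (by rw [htape]; simp only [mact, act]) hB
            have hD : RR S layer w (.pt (sseq qs (m + 1)) (.enter y i), m + 1, π')
                ([] ++ (vs m y ++ evalSubst (vs m) l'))
                (.pt (sseq qs (m + 2)) (.ret x i), m + 2, π) := by
              refine RR.left (st' := .dn1 (sseq qs (m + 1)) y i) ?_ ?_
              · rw [hat, htape]; simp only [mact, act]
              · have := (hs2.trans hA).trans hC
                simpa using this
            exact RR.drop (hπ _ le_rfl) h1 hD
    intro x i π st hst hπ hk
    rw [hv]
    refine inner (σ x).length (σ x) le_rfl x i π st (List.suffix_refl _) ?_ hπ hk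
    rw [hst, htape]
    simp only [act, sseq, htr, Option.bind_some]

theorem top_run
    (hlay : ∀ q a p, S.trans q a = some p →
      (∀ x y, Sum.inr y ∈ p.2 x → layer y ≤ layer x) ∧
      (∀ y : S.X,
        (∑ x ∈ Finset.univ.filter (fun x => layer x = layer y), occCount y (p.2 x)) ≤ 1))
    {qs : ℕ → S.Q} {vs : ℕ → S.X → List B} (hr : IsRun S w w.length qs vs)
    {q : S.Q} {o : List (B ⊕ S.X)} (ho : S.out q = some o) :
    ∀ (N : ℕ) (l : List (B ⊕ S.X)), l.length ≤ N → l <:+ o → ∀ (st : MSt S),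
      mact S layer st (tapeAt w (w.length + 1)) none = topAct S (sseq qs (w.length + 1)) l →
      RR S layer w (st, w.length + 1, []) (evalSubst (vs w.length) l)
        (.fin, w.length + 1, []) := by
  have hend : ∀ (st : MSt S) (u : List B),
      mact S layer st (tapeAt w (w.length + 1)) none = some ((.fin1, MAct.left), u) →
      RR S layer w (st, w.length + 1, []) u (.fin, w.length + 1, []) := by
    intro st u h
    have h1 : RR S layer w (.fin1, w.length, []) ([] ++ []) (.fin, w.length + 1, []) :=
      RR.right rfl le_rfl (by simp [mact]) (RR.refl (by simp))
    have := RR.left (π := []) h h1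
    simpa using this
  intro N
  induction N with
  | zero =>
    intro l hN hl st hst
    obtain rfl : l = [] := by simpa using hN
    exact hend st _ (by rw [hst]; simp [topAct, sp, evalSubst])
  | succ N ih =>
    intro l hN hl st hst
    rcases hsp : (sp l).2 with _ | ⟨y, l'⟩
    · refine hend st _ ?_
      rw [hst, sp_none _ _ hsp]
      simp only [topAct]
      rw [show sp l = ((sp l).1, none) from Prod.ext rfl hsp]
    · obtain ⟨hev, p, hp⟩ := sp_some (vs w.length) l l' y hsp
      have hspl : sp l = ((sp l).1, some (y, l')) := Prod.ext rfl hsp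
      obtain ⟨p0, hp0⟩ := hl
      have hsuf : l' <:+ o := ⟨p0 ++ p ++ [Sum.inr y], by rw [← hp0, hp]; simp⟩
      have hlen' : l'.length ≤ N := by
        rw [hp] at hN; simp at hN; omega
      have hmk : (mkW S l').1 = l' := mkW_val S (Or.inr (Or.inr ⟨_, _, ho, hsuf⟩))
      obtain ⟨st', hs1, hs2⟩ := hu_all (layer := layer) (w := w) (m := w.length) le_rfl
              (fun j hj => hr.hss hj) y (mkW S l') (π := []) (fun j hj => rfl) (by simp)
      have hA := production hlay hr w.length le_rfl y (mkW S l') [] st' hs1 (fun j hj => rfl)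
        (by have := (layer y).2; simp; omega)
      have hB := ih l' hlen' hsuf (.pt (sseq qs (w.length + 1)) (.ret y (mkW S l'))) (by
        rw [tapeAt_rend _ _ le_rfl]
        simp only [mact, act, hmk])
      rw [hev]
      refine RR.left (st' := .dn1 (sseq qs (w.length + 1)) y (mkW S l')) ?_ ?_
      · refine Eq.trans hst ?_
        simp only [topAct]
        rw [hspl]
      · have := (hs2.trans hA).trans hB
        simpa using this

theorem fwd_run {M : ℕ} {qs : ℕ → S.Q} {vs : ℕ → S.X → List B} (hr : IsRun S w M qs vs) :
    ∀ m, m ≤ M → RR S layer w (.pt none .fwd, 0, []) [] (.pt (sseq qs (m + 1)) .fwd, m + 1, []) := by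
  have hl := hr.le
  have one : ∀ m, m ≤ M → RR S layer w (.pt (sseq qs m) .fwd, m, []) ([] ++ [])
      (.pt (sseq qs (m + 1)) .fwd, m + 1, []) := by
    intro m hm
    refine RR.right rfl (by omega) ?_ (RR.refl (by simp))
    have h1 := hr.hss hm
    cases m with
    | zero => 
      rw [tapeAt_zero] at h1 ⊢
      simp only [mact, act, h1, Option.map_some]
    | succ m =>
      obtain ⟨a, σ, ha, _⟩ := hr.step m hm
      rw [tapeAt_of ha] at h1 ⊢
      simp only [mact, act, h1, Option.map_some]
  intro m
  induction m with
  | zero => intro hm; exact one 0 hm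
  | succ m ih => intro hm; exact (ih (by omega)).trans (one (m + 1) hm)

/-- The complete run. -/
theorem full_run
    (hlay : ∀ q a p, S.trans q a = some p →
      (∀ x y, Sum.inr y ∈ p.2 x → layer y ≤ layer x) ∧
      (∀ y : S.X,
        (∑ x ∈ Finset.univ.filter (fun x => layer x = layer y), occCount y (p.2 x)) ≤ 1))
    (w : List A) : ∃ (u : List B) (st : MSt S) (m : ℕ),
      RR S layer w (.pt none .fwd, 0, []) u (st, m, []) ∧
      mact S layer st (tapeAt w m) none = none ∧
      ((st = .fin ∧ m = w.length + 1 ∧ S.eval w = some u) ∨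
        (st ≠ .fin ∧ S.eval w = none)) := by
  obtain ⟨M, qs, vs, hM, h0, h1, h2, h3⟩ := run_decomp (S := S) w S.q0 S.init
  have hr : IsRun S w M qs vs := ⟨hM, h0, h1, h2⟩
  have hf := fwd_run (layer := layer) hr M le_rfl
  rcases h3 with ⟨rfl, h3⟩ | ⟨h3, a, h4, h5⟩
  · rcases ho : S.out (qs w.length) with _ | o
    · refine ⟨_, _, _, hf, ?_, Or.inr ⟨by simp, by simp [SST.eval, h3, ho]⟩⟩
      rw [tapeAt_rend _ _ le_rfl]
      simp only [mact, act, sseq, ho]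
    · have ht := top_run hlay hr ho o.length o le_rfl (List.suffix_refl _)
        (.pt (sseq qs (w.length + 1)) .fwd) (by
          rw [tapeAt_rend _ _ le_rfl]
          simp only [mact, act, sseq, ho])
      exact ⟨_, _, _, hf.trans ht, by simp [mact],
        Or.inl ⟨rfl, rfl, by simp [SST.eval, h3, ho]⟩⟩
  · refine ⟨_, _, _, hf, ?_, Or.inr ⟨by simp, by simp [SST.eval, h3]⟩⟩
    rw [tapeAt_of h4]
    simp [mact, act, sseq, DT, h5]

theorem conclude {T : MarbleT A B} {f : List A → Option (List B)} {fin : T.Q}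
    (hfin : T.final = {fin})
    (hst : ∀ w m π, T.trans fin (tapeAt w m) (marbleAt m π) = none)
    (h : ∀ w : List A, ∃ (u : List B) (st : T.Q) (m : ℕ), BR T w k (T.q0, 0, []) u (st, m, []) ∧
      T.trans st (tapeAt w m) none = none ∧
      ((st = fin ∧ m = w.length + 1 ∧ f w = some u) ∨ (st ≠ fin ∧ f w = none))) :
    T.IsKMarble k ∧ T.Computes f := by
  constructor
  · intro w u cfg hs
    obtain ⟨u0, st, m, h1, h2, _⟩ := h w
    obtain ⟨v, _, h3⟩ := BR.pref (by simp [cstep, marbleAt, h2]) hs h1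
    exact h3.len
  · intro w v
    obtain ⟨u0, st, m, h1, h2, h3⟩ := h w
    constructor
    · intro hv
      rcases h3 with ⟨rfl, rfl, h4⟩ | ⟨_, h4⟩
      · rw [h4] at hv
        cases hv
        exact ⟨_, by simp [hfin], h1.steps⟩
      · rw [h4] at hv; cases hv
    · rintro ⟨q, hq, hs⟩
      rw [hfin] at hq
      obtain rfl : q = fin := hq
      obtain ⟨v', h4, h5⟩ := BR.pref (by simp [cstep, marbleAt, h2]) hs h1
      have hc : cstep T w (q, w.length + 1, []) = none := by
        have := hst w (w.length + 1) []
        simp [cstep, this]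
      cases h5 with
      | nil _ =>
        rcases h3 with ⟨_, _, h6⟩ | ⟨h6, _⟩
        · rw [h6, h4]; simp
        · exact absurd rfl h6
      | cons _ h7 _ => rw [hc] at h7; cases h7

end prod

theorem sst_to_marble {A B : Type} [Fintype A] (k : ℕ) (f : List A → Option (List B))
    (S : SST A B) (hS : S.IsLayered k) (hf : S.Computes f) :
    ∃ T : MarbleT A B, T.IsKMarble k ∧ T.Computes f := by
  obtain ⟨layer, hlay⟩ := hS
  refine ⟨theM S layer, conclude (T := theM S layer) (fin := (.fin : MSt S)) rfl ?_ ?_⟩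
  · intro w m π
    rfl
  · intro w
    obtain ⟨u, st, m, h1, h2, h3⟩ := full_run (layer := layer) hlay w
    rw [hf w] at h3
    exact ⟨u, st, m, h1, h2, h3⟩

end MS

theorem stmt2 {A B : Type} [Fintype A] [Fintype B] (k : ℕ) (f : List A → Option (List B)) :
    (∃ T : MarbleT A B, T.IsKMarble k ∧ T.Computes f) ↔
      (∃ S : SST A B, S.IsLayered k ∧ S.Computes f) := by
  constructor
  · rintro ⟨T, h1, h2⟩
    exact MS.marble_to_sst k f T h1 h2
  · rintro ⟨S, h1, h2⟩
    exact MS.sst_to_marble k f S h1 h2
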